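/- arXiv:1211.4998 — 9 statements merged into one kernel-verified Lean document; each statement's English description precedes it below -/
import Mathlib

section
/- Let G be a finite simple graph on n vertices with maximum degree Δ(G) ≥ (2/3)n − 1. Then G admits an equitable ⌈(Δ(G)+1)/2⌉-tree-coloring; equivalently, a_eq(G) ≤ ⌈(Δ(G)+1)/2⌉. -/
/-- An *equitable `k`-tree-coloring* of a graph `G` on `n` vertices: a partition of the
vertex set into `k` classes (fibers of a map to `Fin k`), each of size `⌊n/k⌋` or `⌈n/k⌉`,
such that each class induces a forest (acyclic subgraph) of `G`. -/
def SimpleGraph.EquitableTreeColoring {V : Type*} [Fintype V] (G : SimpleGraph V)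
    (k : ℕ) : Prop :=
  ∃ f : V → Fin k,
    (∀ i : Fin k,
      (Finset.univ.filter fun v => f v = i).card = Fintype.card V / k ∨
      (Finset.univ.filter fun v => f v = i).card = (Fintype.card V + k - 1) / k) ∧
    ∀ i : Fin k, (G.induce (f ⁻¹' {i})).IsAcyclic

theorem match_add {V : Type*} (H : SimpleGraph V) (m : ℕ) (a b : ℕ → V)
    (ha : ∀ i < m, ∀ j < m, a i = a j → i = j) (hb : ∀ i < m, ∀ j < m, b i = b j → i = j)
    (hab : ∀ i < m, ∀ j < m, a i ≠ b j) (hadj : ∀ i < m, H.Adj (a i) (b i)) (x y : V)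
    (h1 : ∀ i < m, a i ≠ x ∧ b i ≠ x) (h2 : ∀ i < m, a i ≠ y ∧ b i ≠ y)
    (hxy : H.Adj x y) :
    ∃ a b : ℕ → V, (∀ i < m + 1, ∀ j < m + 1, a i = a j → i = j) ∧
      (∀ i < m + 1, ∀ j < m + 1, b i = b j → i = j) ∧
      (∀ i < m + 1, ∀ j < m + 1, a i ≠ b j) ∧ (∀ i < m + 1, H.Adj (a i) (b i)) := by
  have h3 := hxy.ne
  refine ⟨fun j => if j = m then x else a j, fun j => if j = m then y else b j, ?_, ?_, ?_, ?_⟩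
  · intro i hi j hj; dsimp only; grind
  · intro i hi j hj; dsimp only; grind
  · intro i hi j hj; dsimp only; grind
  · intro i hi; dsimp only; grind

theorem match_aug {V : Type*} (H : SimpleGraph V) (m : ℕ) (a b : ℕ → V)
    (ha : ∀ i < m, ∀ j < m, a i = a j → i = j) (hb : ∀ i < m, ∀ j < m, b i = b j → i = j)
    (hab : ∀ i < m, ∀ j < m, a i ≠ b j) (hadj : ∀ i < m, H.Adj (a i) (b i)) (x y : V)
    (h1 : ∀ i < m, a i ≠ x ∧ b i ≠ x) (h2 : ∀ i < m, a i ≠ y ∧ b i ≠ y)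
    (hxy : x ≠ y) (l : ℕ) (hl : l < m) (hxa : H.Adj x (a l)) (hyb : H.Adj y (b l)) :
    ∃ a b : ℕ → V, (∀ i < m + 1, ∀ j < m + 1, a i = a j → i = j) ∧
      (∀ i < m + 1, ∀ j < m + 1, b i = b j → i = j) ∧
      (∀ i < m + 1, ∀ j < m + 1, a i ≠ b j) ∧ (∀ i < m + 1, H.Adj (a i) (b i)) := by
  have h3 := hxa.symm
  refine ⟨fun j => if j = m then y else a j,
    fun j => if j = m then b l else if j = l then x else b j, ?_, ?_, ?_, ?_⟩
  · intro i hi j hj; dsimp only; grind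
  · intro i hi j hj; dsimp only; grind
  · intro i hi j hj; dsimp only; grind
  · intro i hi; dsimp only; grind

open Finset in
theorem matching_step {V : Type*} [Fintype V] [DecidableEq V] (H : SimpleGraph V)
    [DecidableRel H.Adj] (t m : ℕ) (hd : ∀ v, t ≤ H.degree v) (hn : 2 * t ≤ Fintype.card V)
    (hm : m < t) (a b : ℕ → V)
    (ha : ∀ i < m, ∀ j < m, a i = a j → i = j) (hb : ∀ i < m, ∀ j < m, b i = b j → i = j)
    (hab : ∀ i < m, ∀ j < m, a i ≠ b j) (hadj : ∀ i < m, H.Adj (a i) (b i)) :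
    ∃ a b : ℕ → V, (∀ i < m + 1, ∀ j < m + 1, a i = a j → i = j) ∧
      (∀ i < m + 1, ∀ j < m + 1, b i = b j → i = j) ∧
      (∀ i < m + 1, ∀ j < m + 1, a i ≠ b j) ∧ (∀ i < m + 1, H.Adj (a i) (b i)) := by
  set S : Finset V := (range m).image a ∪ (range m).image b with hS
  have hScard : #S ≤ 2 * m := by
    have h1 := card_union_le ((range m).image a) ((range m).image b)
    have h2 := card_image_le (s := range m) (f := a)
    have h3 := card_image_le (s := range m) (f := b)
    simp only [card_range] at h2 h3
    rw [← hS] at h1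
    omega
  have hc : 1 < #(Sᶜ) := by rw [card_compl]; omega
  obtain ⟨u, hu, v, hv, huv⟩ := one_lt_card.1 hc
  have notS : ∀ w, w ∈ Sᶜ → ∀ i < m, a i ≠ w ∧ b i ≠ w := by
    intro w hw i hi
    simp only [hS, mem_compl, mem_union, mem_image, mem_range, not_or, not_exists, not_and] at hw
    exact ⟨hw.1 i hi, hw.2 i hi⟩
  by_contra hno
  have hdeg : ∀ w ∈ Sᶜ, H.degree w ≤
      ∑ i ∈ range m, ((if H.Adj w (a i) then 1 else 0) + (if H.Adj w (b i) then 1 else 0)) := by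
    intro w hw
    rw [sum_add_distrib, ← card_filter, ← card_filter, ← H.card_neighborFinset_eq_degree]
    refine (card_le_card (t := ((range m).filter fun i => H.Adj w (a i)).image a ∪
      ((range m).filter fun i => H.Adj w (b i)).image b) ?_).trans
      ((card_union_le _ _).trans (add_le_add card_image_le card_image_le))
    intro z hz
    rw [SimpleGraph.mem_neighborFinset] at hz
    have hzS : z ∈ S := by
      by_contra hzS
      exact hno (match_add H m a b ha hb hab hadj w z (notS w hw)
        (notS z (by simpa using hzS)) hz)
    simp only [hS, mem_union, mem_image, mem_range, mem_filter] at hzS ⊢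
    rcases hzS with ⟨i, hi, rfl⟩ | ⟨i, hi, rfl⟩
    · exact Or.inl ⟨i, ⟨hi, hz⟩, rfl⟩
    · exact Or.inr ⟨i, ⟨hi, hz⟩, rfl⟩
  have h1 := (hd u).trans (hdeg u hu)
  have h2 := (hd v).trans (hdeg v hv)
  have h3 := add_le_add h1 h2
  rw [← sum_add_distrib] at h3
  have h4 := sum_le_card_nsmul (range m) (fun i =>
    ((if H.Adj u (a i) then 1 else 0) + (if H.Adj u (b i) then 1 else 0)) +
    ((if H.Adj v (a i) then 1 else 0) + (if H.Adj v (b i) then 1 else 0))) 2 (by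
      intro i hi
      have hi := mem_range.1 hi
      have e1 : ¬ (H.Adj u (a i) ∧ H.Adj v (b i)) := fun h =>
        hno (match_aug H m a b ha hb hab hadj u v (notS u hu) (notS v hv) huv i hi h.1 h.2)
      have e2 : ¬ (H.Adj v (a i) ∧ H.Adj u (b i)) := fun h =>
        hno (match_aug H m a b ha hb hab hadj v u (notS v hv) (notS u hu) huv.symm i hi h.1 h.2)
      clear hdeg h1 h2 h3 hno hd
      by_cases p1 : H.Adj u (a i) <;> by_cases p2 : H.Adj u (b i) <;>
        by_cases p3 : H.Adj v (a i) <;> by_cases p4 : H.Adj v (b i) <;>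
        simp only [p1, p2, p3, p4, if_true, if_false, and_true, not_true] at e1 e2 ⊢ <;>
        norm_num)
  rw [card_range, smul_eq_mul] at h4
  have h5 : t + t ≤ m * 2 := h3.trans h4
  clear h1 h2 h3 h4 hdeg
  omega

theorem exists_matching {V : Type*} [Fintype V] [DecidableEq V] [Nonempty V] (H : SimpleGraph V)
    [DecidableRel H.Adj] (t : ℕ) (hd : ∀ v, t ≤ H.degree v) (hn : 2 * t ≤ Fintype.card V) :
    ∀ m ≤ t, ∃ a b : ℕ → V, (∀ i < m, ∀ j < m, a i = a j → i = j) ∧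
      (∀ i < m, ∀ j < m, b i = b j → i = j) ∧
      (∀ i < m, ∀ j < m, a i ≠ b j) ∧ (∀ i < m, H.Adj (a i) (b i)) := by
  intro m
  induction m with
  | zero =>
    intro _
    obtain ⟨x⟩ := ‹Nonempty V›
    exact ⟨fun _ => x, fun _ => x, by simp⟩
  | succ m ih =>
    intro hm
    obtain ⟨a, b, h1, h2, h3, h4⟩ := ih (by omega)
    exact matching_step H t m hd hn (by omega) a b h1 h2 h3 h4

theorem acyclic_of_small {W : Type*} (K : SimpleGraph W) (g : W → Fin 3)
    (hg : Function.Injective g)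
    (hK : ∀ x y z, g x = 0 → g y = 1 → g z = 2 → ¬ K.Adj x y) : K.IsAcyclic := by
  classical
  have : Fintype W := Fintype.ofInjective g hg
  have hW : Fintype.card W ≤ 3 := by simpa using Fintype.card_le_of_injective g hg
  intro v c hc
  have h1 := hc.three_le_length
  have h2 := hc.support_nodup.length_le_card
  simp only [List.length_tail, SimpleGraph.Walk.length_support] at h2
  have h3 : c.length = 3 := by omega
  obtain ⟨s, hs⟩ := K.is3Clique_iff_exists_cycle_length_three.2 ⟨v, c, hc, h3⟩
  have himg : s.image g = Finset.univ := by
    rw [← Finset.card_eq_iff_eq_univ, Finset.card_image_of_injective _ hg, hs.card_eq]; rfl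
  have hex : ∀ i, ∃ x ∈ s, g x = i := fun i => by
    have : i ∈ s.image g := by rw [himg]; exact Finset.mem_univ _
    simpa using this
  obtain ⟨x, hx, gx⟩ := hex 0
  obtain ⟨y, hy, gy⟩ := hex 1
  obtain ⟨z, hz, gz⟩ := hex 2
  refine hK x y z gx gy gz (hs.isClique hx hy ?_)
  rintro rfl
  rw [gx] at gy
  exact absurd gy (by decide)

theorem card_mod_fiber (n k i : ℕ) (hk : 0 < k) (hi : i < k) :
    (Finset.univ.filter fun j : Fin n => j.val % k = i).card = n / k ∨
    (Finset.univ.filter fun j : Fin n => j.val % k = i).card = (n + k - 1) / k := by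
  have h0 : (Finset.univ.filter fun j : Fin n => j.val % k = i).card
      = Nat.count (· ≡ i [MOD k]) n := by
    rw [Nat.count_eq_card_filter_range, Finset.card_filter, Finset.card_filter,
      Finset.sum_range]
    simp [Nat.ModEq, Nat.mod_eq_of_lt hi]
  rw [h0, Nat.count_modEq_card n hk]
  split_ifs with h
  · right
    have h1 := Nat.div_add_mod n k
    have : n + k - 1 = (n % k - 1) + k * (n / k + 1) := by
      rw [mul_add]; omega
    rw [this, Nat.add_mul_div_left _ _ hk,
      Nat.div_eq_of_lt (by have := Nat.mod_lt n hk; omega : n % k - 1 < k), zero_add]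
  · left; rfl

theorem coloring_of_le {V : Type*} [Fintype V] (G : SimpleGraph V) [DecidableRel G.Adj]
    (k : ℕ) (hk0 : 0 < k) (hk : G.maxDegree + 1 ≤ 2 * k) (hn : Fintype.card V ≤ 3 * k) :
    G.EquitableTreeColoring k := by
  classical
  rcases isEmpty_or_nonempty V with hV | hV
  · refine ⟨isEmptyElim, fun i => Or.inl ?_, fun i v => isEmptyElim v.1⟩
    simp [Finset.univ_eq_empty]
  set n := Fintype.card V with hnV
  set t := n - 2 * k with ht
  obtain ⟨a, b, ha, hb, hab, hadj⟩ := exists_matching Gᶜ t (by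
    intro v
    rw [SimpleGraph.degree_compl]
    have := G.degree_le_maxDegree v
    omega) (by omega) t le_rfl
  obtain ⟨e, he⟩ := Finset.exists_equiv_extend_of_card_eq (α := Fin n)
    (t := (Finset.univ : Finset V)) (by simp [hnV])
    (s := Finset.univ.filter fun j : Fin n => j.val < t ∨ (k ≤ j.val ∧ j.val < k + t))
    (f := fun j : Fin n => if j.val < k then a j else b (j - k)) (by simp) (by
      intro x hx y hy hxy
      simp only [Finset.coe_filter, Finset.mem_univ, true_and, Set.mem_ofPred_eq] at hx hy
      dsimp only at hxy
      apply Fin.ext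
      split_ifs at hxy with h1 h2 h2
      · exact ha _ (by omega) _ (by omega) hxy
      · exact absurd hxy (hab _ (by omega) _ (by omega))
      · exact absurd hxy.symm (hab _ (by omega) _ (by omega))
      · have := hb _ (by omega) _ (by omega) hxy
        omega)
  let e' : Fin n ≃ V := e.trans (Equiv.subtypeUnivEquiv (by simp))
  have he' : ∀ j : Fin n, (j.val < t ∨ (k ≤ j.val ∧ j.val < k + t)) →
      e' j = if j.val < k then a j else b (j - k) := by
    intro j hj
    exact he j (by simpa using hj)
  refine ⟨fun v => ⟨(e'.symm v).val % k, Nat.mod_lt _ hk0⟩, ?_, ?_⟩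
  · intro i
    have : (Finset.univ.filter fun v => (⟨(e'.symm v).val % k, Nat.mod_lt _ hk0⟩ : Fin k) = i).card
        = (Finset.univ.filter fun j : Fin n => j.val % k = i.val).card := by
      refine Finset.card_equiv e'.symm ?_
      intro v
      simp [Fin.ext_iff]
    rw [this]
    exact card_mod_fiber n k i hk0 i.2
  · intro i
    have hlt : ∀ v, (e'.symm v).val / k < 3 := fun v => by
      rw [Nat.div_lt_iff_lt_mul hk0]
      have := (e'.symm v).2
      omega
    have hi : ∀ v : ((fun v => (⟨(e'.symm v).val % k, Nat.mod_lt _ hk0⟩ : Fin k)) ⁻¹' {i}),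
        (e'.symm v.1).val = k * ((e'.symm v.1).val / k) + i.val := by
      rintro ⟨v, hv⟩
      have h1 : (e'.symm v).val % k = i.val := congrArg Fin.val hv
      have := Nat.div_add_mod (e'.symm v).val k
      rw [h1] at this
      exact this.symm
    refine acyclic_of_small _ (fun v => ⟨(e'.symm v.1).val / k, hlt v.1⟩) ?_ ?_
    · intro x y hxy
      have h1 : (e'.symm x.1).val / k = (e'.symm y.1).val / k := congrArg Fin.val hxy
      have h2 := hi x
      rw [h1, ← hi y] at h2
      exact Subtype.ext (e'.symm.injective (Fin.ext h2))
    · intro x y z hx hy hz hxyadj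
      have hx' := hi x
      have hy' := hi y
      have hz' := hi z
      rw [show (e'.symm x.1).val / k = 0 from congrArg Fin.val hx] at hx'
      rw [show (e'.symm y.1).val / k = 1 from congrArg Fin.val hy] at hy'
      rw [show (e'.symm z.1).val / k = 2 from congrArg Fin.val hz] at hz'
      have hzn := (e'.symm z.1).2
      have hik := i.2
      have hit : i.val < t := by omega
      have ex := he' (e'.symm x.1) (by omega)
      have ey := he' (e'.symm y.1) (by omega)
      rw [if_pos (by omega), Equiv.apply_symm_apply] at ex
      rw [if_neg (by omega), Equiv.apply_symm_apply] at ey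
      rw [show (e'.symm x.1).val = i.val by omega] at ex
      rw [show (e'.symm y.1).val - k = i.val by omega] at ey
      have h5 := hadj i.val hit
      rw [← ex, ← ey, SimpleGraph.compl_adj] at h5
      exact h5.2 hxyadj

/-- If `Δ(G) ≥ (2/3)·n − 1`, then `G` admits an equitable `⌈(Δ(G)+1)/2⌉`-tree-coloring. -/
theorem equitableTreeColoring_of_twoThirds_sub_one_le_maxDegree
    {V : Type*} [Fintype V] (G : SimpleGraph V) [DecidableRel G.Adj]
    (h : (G.maxDegree : ℝ) ≥ 2 / 3 * Fintype.card V - 1) :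
    G.EquitableTreeColoring ((G.maxDegree + 2) / 2) := by
  have h1 : 2 * Fintype.card V ≤ 3 * (G.maxDegree + 1) := by
    have : (2 * Fintype.card V : ℝ) ≤ 3 * (G.maxDegree + 1) := by linarith
    exact_mod_cast this
  exact coloring_of_le G _ (by omega) (by omega) (by omega)
end

section
/- Let G be a finite simple graph on n vertices with maximum degree Δ(G) satisfying (2/3)n − 1 > Δ(G) ≥ (2/3)n − 2. Then G admits an equitable ⌈(Δ(G)+1)/2⌉-tree-coloring; equivalently, a_eq(G) ≤ ⌈(Δ(G)+1)/2⌉. -/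
open Classical in
theorem aux_acyclic {V : Type*} (G : SimpleGraph V) (C : Set V)
    (h : ∀ T : Finset V, T.Nonempty → (∀ v ∈ T, v ∈ C) →
      (∀ v ∈ T, ∃ p ∈ T, ∃ q ∈ T, p ≠ q ∧ G.Adj v p ∧ G.Adj v q) → False) :
    (G.induce C).IsAcyclic := by
  intro v c hc
  refine h (c.support.toFinset.image Subtype.val) ⟨v, by simp⟩ ?_ ?_
  · intro w hw
    simp only [Finset.mem_image] at hw
    obtain ⟨x, -, rfl⟩ := hw
    exact x.2
  · intro w hw
    simp only [Finset.mem_image, List.mem_toFinset] at hw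
    obtain ⟨x, hx, rfl⟩ := hw
    have hr := hc.rotate hx
    have hmem : ∀ y, y ∈ (c.rotate x hx).support ↔ y ∈ c.support := by
      intro y
      exact SimpleGraph.Walk.mem_support_rotate_iff _ _ hx
    refine ⟨(c.rotate x hx).snd, ?_, (c.rotate x hx).penultimate, ?_, ?_, ?_, ?_⟩
    · simp only [Finset.mem_image, List.mem_toFinset]
      exact ⟨_, (hmem _).1 (SimpleGraph.Walk.getVert_mem_support _ _), rfl⟩
    · simp only [Finset.mem_image, List.mem_toFinset]
      exact ⟨_, (hmem _).1 (SimpleGraph.Walk.getVert_mem_support _ _), rfl⟩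
    · intro e
      exact hr.snd_ne_penultimate (Subtype.ext e)
    · exact (SimpleGraph.Walk.adj_snd hr.not_nil)
    · exact (SimpleGraph.Walk.adj_penultimate hr.not_nil).symm

open Classical in
theorem aux_extend {V : Type*} [Fintype V] {k : ℕ} (c : Fin k → ℕ)
    (hc : ∑ i, c i = Fintype.card V) (m : ℕ) : ∀ (P : Fin k → Finset V),
    (∀ i j v, v ∈ P i → v ∈ P j → i = j) → (∀ i, (P i).card ≤ c i) →
    Fintype.card V ≤ ∑ i, (P i).card + m →
    ∃ f : V → Fin k, (∀ i, (Finset.univ.filter fun v => f v = i).card = c i) ∧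
      ∀ i, ∀ v ∈ P i, f v = i := by
  induction m with
  | zero =>
    intro P hd hP hm
    have heq : ∀ i, (P i).card = c i := by
      have := (Finset.sum_eq_sum_iff_of_le (s := Finset.univ) (fun i _ => hP i)).1
        (le_antisymm (Finset.sum_le_sum fun i _ => hP i) (by omega))
      intro i; exact this i (Finset.mem_univ i)
    have hcard : (Finset.univ.biUnion P).card = ∑ i, (P i).card := by
      apply Finset.card_biUnion
      intro i _ j _ hij
      refine Finset.disjoint_left.2 ?_
      intro v h1 h2
      exact hij (hd i j v h1 h2)
    have huniv : Finset.univ.biUnion P = Finset.univ := by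
      rw [← Finset.card_eq_iff_eq_univ]
      have := Finset.card_le_univ (Finset.univ.biUnion P)
      omega
    have hex : ∀ v, ∃ i, v ∈ P i := by
      intro v
      have : v ∈ Finset.univ.biUnion P := by rw [huniv]; simp
      simpa using this
    choose f hf using hex
    have hfP : ∀ i, ∀ v ∈ P i, f v = i := fun i v hv => hd _ _ v (hf v) hv
    refine ⟨f, fun i => ?_, hfP⟩
    rw [← heq i]
    congr 1
    ext v
    simp only [Finset.mem_filter, Finset.mem_univ, true_and]
    exact ⟨fun h => h ▸ hf v, hfP i v⟩
  | succ m ih =>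
    intro P hd hP hm
    by_cases hlt : Fintype.card V ≤ ∑ i, (P i).card + m
    · exact ih P hd hP hlt
    have hcard : (Finset.univ.biUnion P).card ≤ ∑ i, (P i).card := Finset.card_biUnion_le
    have hv : ∃ v, v ∉ Finset.univ.biUnion P := by
      by_contra! hcon
      have : Finset.univ.biUnion P = Finset.univ := by ext; simp [hcon]
      rw [this, Finset.card_univ] at hcard
      omega
    obtain ⟨v, hv⟩ := hv
    have hv' : ∀ i, v ∉ P i := by simpa using hv
    have hi : ∃ i, (P i).card < c i := by
      by_contra! hcon
      have := Finset.sum_le_sum (s := Finset.univ) fun i _ => hcon i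
      omega
    obtain ⟨i, hi⟩ := hi
    obtain ⟨f, hf1, hf2⟩ := ih (fun j => if j = i then insert v (P i) else P j) (by
        intro j l w
        by_cases hj : j = i <;> by_cases hl : l = i <;> simp only [hj, hl, if_true, if_false]
        · simp
        · intro h1 h2
          rcases Finset.mem_insert.1 h1 with rfl | h1
          · exact absurd h2 (hv' _)
          · exact hd _ _ w h1 h2
        · intro h1 h2
          rcases Finset.mem_insert.1 h2 with rfl | h2
          · exact absurd h1 (hv' _)
          · exact absurd (hd _ _ w h1 h2) hj
        · exact hd _ _ w) (by
        intro j
        by_cases hj : j = i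
        · subst hj
          simp only [if_true]
          rw [Finset.card_insert_of_notMem (hv' _)]; omega
        · simp only [hj, if_false]; exact hP j) (by
        have : ∑ j, (P j).card < ∑ j, (if j = i then insert v (P i) else P j).card := by
          apply Finset.sum_lt_sum
          · intro j _
            by_cases hj : j = i
            · subst hj
              simp only [if_true]
              exact Finset.card_le_card (Finset.subset_insert _ _)
            · simp only [hj, if_false]; exact le_rfl
          · refine ⟨i, Finset.mem_univ _, ?_⟩
            simp only [if_true]
            rw [Finset.card_insert_of_notMem (hv' _)]; omega
        omega)
    refine ⟨f, hf1, fun j w hw => hf2 j w ?_⟩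
    by_cases hj : j = i
    · subst hj; simp [hw]
    · simp [hj, hw]

/-- `a i - b i` (for `i : Fin s`) is a matching of `H`. -/
def IsMatch {V : Type*} (H : SimpleGraph V) {s : ℕ} (a b : Fin s → V) : Prop :=
  Function.Injective a ∧ Function.Injective b ∧ (∀ i j, a i ≠ b j) ∧ ∀ i, H.Adj (a i) (b i)

theorem IsMatch.cons {V : Type*} {H : SimpleGraph V} {s : ℕ} {a b : Fin s → V}
    (h : IsMatch H a b) {x y : V} (hxy : H.Adj x y)
    (hx : ∀ i, x ≠ a i ∧ x ≠ b i) (hy : ∀ i, y ≠ a i ∧ y ≠ b i) :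
    IsMatch H (Fin.cons x a : Fin (s+1) → V) (Fin.cons y b : Fin (s+1) → V) := by
  obtain ⟨ha, hb, hab, hadj⟩ := h
  refine ⟨?_, ?_, ?_, ?_⟩
  · rw [Fin.cons_injective_iff]
    exact ⟨fun ⟨i, hi⟩ => (hx i).1 hi.symm, ha⟩
  · rw [Fin.cons_injective_iff]
    exact ⟨fun ⟨i, hi⟩ => (hy i).2 hi.symm, hb⟩
  · intro i j
    refine Fin.cases ?_ (fun i => ?_) i <;> refine Fin.cases ?_ (fun j => ?_) j
    · simpa using hxy.ne
    · simpa using (hx j).2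
    · simpa using (hy i).1.symm
    · simpa using hab i j
  · intro i
    refine Fin.cases ?_ (fun i => ?_) i
    · simpa using hxy
    · simpa using hadj i

theorem IsMatch.symm {V : Type*} {H : SimpleGraph V} {s : ℕ} {a b : Fin s → V}
    (h : IsMatch H a b) : IsMatch H b a :=
  ⟨h.2.1, h.1, fun i j => (h.2.2.1 j i).symm, fun i => (h.2.2.2 i).symm⟩

theorem IsMatch.augment {V : Type*} {H : SimpleGraph V} {s : ℕ} {a b : Fin s → V}
    (h : IsMatch H a b) {u v : V} (huv : u ≠ v)
    (hu : ∀ i, u ≠ a i ∧ u ≠ b i) (hv : ∀ i, v ≠ a i ∧ v ≠ b i)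
    (i : Fin s) (h1 : H.Adj (a i) u) (h2 : H.Adj (b i) v) :
    ∃ a' b' : Fin (s+1) → V, IsMatch H a' b' := by
  have hm : IsMatch H a (Function.update b i u) := by
    obtain ⟨ha, hb, hab, hadj⟩ := h
    refine ⟨ha, ?_, ?_, ?_⟩
    · intro p q hpq
      by_cases hp : p = i <;> by_cases hq : q = i
      · rw [hp, hq]
      · subst hp; simp [hq] at hpq; exact absurd hpq (hu q).2
      · subst hq; simp [hp] at hpq; exact absurd hpq.symm (hu p).2
      · simp [hp, hq] at hpq; exact hb hpq
    · intro p q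
      by_cases hq : q = i
      · subst hq; simpa using (hu p).1.symm
      · simpa [hq] using hab p q
    · intro p
      by_cases hq : p = i
      · subst hq; simpa using h1
      · simpa [hq] using hadj p
  refine ⟨_, _, hm.cons (x := b i) (y := v) h2 ?_ ?_⟩
  · intro p
    refine ⟨(h.2.2.1 p i).symm, ?_⟩
    by_cases hq : p = i
    · subst hq; simpa using (hu p).2.symm
    · simpa [hq] using fun e => hq (h.2.1 e).symm
  · intro p
    refine ⟨(hv p).1, ?_⟩
    by_cases hq : p = i
    · subst hq; simpa using huv.symm
    · simpa [hq] using (hv p).2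

open Classical in
theorem aux_deg {V : Type*} [Fintype V] (H : SimpleGraph V) {s : ℕ} (a b : Fin s → V) (u : V)
    (h : ∀ w, H.Adj u w → (∃ i, w = a i) ∨ (∃ i, w = b i)) :
    H.degree u ≤ ∑ i, ((if H.Adj u (a i) then 1 else 0) + (if H.Adj u (b i) then 1 else 0)) := by
  rw [Finset.sum_add_distrib, ← Finset.card_filter, ← Finset.card_filter]
  rw [← SimpleGraph.card_neighborFinset_eq_degree]
  refine le_trans (Finset.card_le_card (t := (Finset.univ.filter fun i => H.Adj u (a i)).image a ∪
    (Finset.univ.filter fun i => H.Adj u (b i)).image b) ?_) ?_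
  · intro w hw
    rw [SimpleGraph.mem_neighborFinset] at hw
    simp only [Finset.mem_union, Finset.mem_image, Finset.mem_filter, Finset.mem_univ, true_and]
    rcases h w hw with ⟨i, rfl⟩ | ⟨i, rfl⟩
    · exact Or.inl ⟨i, hw, rfl⟩
    · exact Or.inr ⟨i, hw, rfl⟩
  · exact (Finset.card_union_le _ _).trans (add_le_add Finset.card_image_le Finset.card_image_le)

open Classical in
theorem aux_matching {V : Type*} [Fintype V] (H : SimpleGraph V) (d : ℕ)
    (hd : ∀ v, d ≤ H.degree v) (hn : 2 * d ≤ Fintype.card V) (s : ℕ) (hs : s ≤ d) :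
    ∃ a b : Fin s → V, IsMatch H a b := by
  induction s with
  | zero => exact ⟨Fin.elim0, Fin.elim0, fun i => i.elim0, fun i => i.elim0, fun i => i.elim0,
      fun i => i.elim0⟩
  | succ s ih =>
    obtain ⟨a, b, hm⟩ := ih (by omega)
    set U := Finset.univ.image a ∪ Finset.univ.image b with hU
    have hUc : U.card ≤ 2 * s := by
      refine (Finset.card_union_le _ _).trans ?_
      have h1 := Finset.card_image_le (s := Finset.univ) (f := a)
      have h2 := Finset.card_image_le (s := Finset.univ) (f := b)
      simp only [Finset.card_univ, Fintype.card_fin] at h1 h2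
      omega
    have h2 : 1 < Uᶜ.card := by
      rw [Finset.card_compl]; omega
    obtain ⟨u, hu, v, hv, huv⟩ := Finset.one_lt_card.1 h2
    have key : ∀ w, w ∈ Uᶜ → ∀ i, w ≠ a i ∧ w ≠ b i := by
      intro w hw i
      simp only [hU, Finset.mem_compl, Finset.mem_union, Finset.mem_image, Finset.mem_univ,
        true_and, not_or, not_exists] at hw
      exact ⟨fun e => hw.1 i e.symm, fun e => hw.2 i e.symm⟩
    by_cases hout : ∃ x ∈ Uᶜ, ∃ y ∈ Uᶜ, H.Adj x y
    · obtain ⟨x, hx, y, hy, hxy⟩ := hout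
      exact ⟨_, _, hm.cons hxy (key x hx) (key y hy)⟩
    have hin : ∀ x ∈ Uᶜ, ∀ w, H.Adj x w → (∃ i, w = a i) ∨ (∃ i, w = b i) := by
      intro x hx w hxw
      by_contra hcon
      refine hout ⟨x, hx, w, ?_, hxw⟩
      simp only [hU, Finset.mem_compl, Finset.mem_union, Finset.mem_image, Finset.mem_univ,
        true_and]
      rintro (⟨i, hi⟩ | ⟨i, hi⟩)
      · exact hcon (Or.inl ⟨i, hi.symm⟩)
      · exact hcon (Or.inr ⟨i, hi.symm⟩)
    have du := aux_deg H a b u (hin u hu)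
    have dv := aux_deg H a b v (hin v hv)
    have hu' := hd u
    have hv' := hd v
    have hi : ∃ i, 2 < (((if H.Adj u (a i) then 1 else 0) + (if H.Adj u (b i) then 1 else 0)) +
        ((if H.Adj v (a i) then 1 else 0) + (if H.Adj v (b i) then 1 else 0)) : ℕ) := by
      by_contra! hcon
      have := Finset.sum_le_sum (s := Finset.univ) fun i _ => hcon i
      rw [Finset.sum_add_distrib] at this
      simp only [Finset.sum_const, Finset.card_univ, Fintype.card_fin, smul_eq_mul] at this
      omega
    obtain ⟨i, hi⟩ := hi
    have hcase : (H.Adj (a i) u ∧ H.Adj (b i) v) ∨ (H.Adj (a i) v ∧ H.Adj (b i) u) := by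
      rw [H.adj_comm (a i), H.adj_comm (b i), H.adj_comm (a i), H.adj_comm (b i)]
      by_contra hcon
      split_ifs at hi <;> first | omega | tauto
    rcases hcase with ⟨h1, h2⟩ | ⟨h1, h2⟩
    · exact hm.augment huv (key u hu) (key v hv) i h1 h2
    · exact hm.augment huv.symm (key v hv) (key u hu) i h1 h2

open Classical in
/-- A class with at most three vertices, two of which are not adjacent. -/
theorem aux_three {V : Type*} [Fintype V] (G : SimpleGraph V) {k : ℕ} (f : V → Fin k) (i : Fin k)
    (hcard : (Finset.univ.filter fun v => f v = i).card ≤ 3) {x y : V} (hx : f x = i)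
    (hy : f y = i) (hxy : Gᶜ.Adj x y) : (G.induce (f ⁻¹' {i})).IsAcyclic := by
  rw [SimpleGraph.compl_adj] at hxy
  obtain ⟨hne, hna⟩ := hxy
  set F := Finset.univ.filter fun v => f v = i with hF
  have hsmall : ((F.erase x).erase y).card ≤ 1 := by
    rw [Finset.card_erase_of_mem, Finset.card_erase_of_mem]
    · omega
    · simp [hF, hx]
    · simp [hF, hy, hne.symm]
  rw [Finset.card_le_one] at hsmall
  have hsm : ∀ p q, f p = i → f q = i → p ≠ x → p ≠ y → q ≠ x → q ≠ y → p = q := by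
    intro p q h1 h2 h3 h4 h5 h6
    exact hsmall p (by simp [hF, h1, h3, h4]) q (by simp [hF, h2, h5, h6])
  apply aux_acyclic
  intro T hT hTC hT2
  have hTC' : ∀ v ∈ T, f v = i := fun v hv => hTC v hv
  have hxT : x ∉ T := by
    intro hm
    obtain ⟨p, hp, q, hq, hpq, h1, h2⟩ := hT2 x hm
    exact hpq (hsm p q (hTC' p hp) (hTC' q hq) h1.ne' (fun e => hna (e ▸ h1)) h2.ne'
      (fun e => hna (e ▸ h2)))
  have hyT : y ∉ T := by
    intro hm
    obtain ⟨p, hp, q, hq, hpq, h1, h2⟩ := hT2 y hm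
    exact hpq (hsm p q (hTC' p hp) (hTC' q hq) (fun e => hna (e ▸ h1).symm) h1.ne' 
      (fun e => hna (e ▸ h2).symm) h2.ne')
  obtain ⟨v, hv⟩ := hT
  obtain ⟨p, hp, q, hq, hpq, h1, h2⟩ := hT2 v hv
  exact hpq (hsm p q (hTC' p hp) (hTC' q hq) (fun e => hxT (e ▸ hp)) (fun e => hyT (e ▸ hp))
    (fun e => hxT (e ▸ hq)) (fun e => hyT (e ▸ hq)))

open Classical in
/-- A class with at most four vertices spanned by a path `y x z w` in the complement. -/
theorem aux_four {V : Type*} [Fintype V] (G : SimpleGraph V) {k : ℕ} (f : V → Fin k) (i : Fin k)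
    (hcard : (Finset.univ.filter fun v => f v = i).card ≤ 4) {y x z w : V} (hy : f y = i)
    (hx : f x = i) (hz : f z = i) (hw : f w = i) (hyx : ¬ G.Adj y x) (hxz : ¬ G.Adj x z)
    (hzw : ¬ G.Adj z w) (hne : ({y, x, z, w} : Finset V).card = 4) :
    (G.induce (f ⁻¹' {i})).IsAcyclic := by
  have hsub : ({y, x, z, w} : Finset V) ⊆ Finset.univ.filter fun v => f v = i := by
    intro v hv
    simp only [Finset.mem_insert, Finset.mem_singleton] at hv
    rcases hv with rfl | rfl | rfl | rfl <;> simp [*]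
  have heq := Finset.eq_of_subset_of_card_le hsub (by omega)
  have hall : ∀ v, f v = i → v = y ∨ v = x ∨ v = z ∨ v = w := by
    intro v hv
    have : v ∈ ({y, x, z, w} : Finset V) := by rw [heq]; simp [hv]
    simpa using this
  apply aux_acyclic
  intro T hT hTC hT2
  have hTC' : ∀ v ∈ T, v = y ∨ v = x ∨ v = z ∨ v = w := fun v hv => hall v (hTC v hv)
  have hxT : x ∉ T := by
    intro hm
    obtain ⟨p, hp, q, hq, hpq, h1, h2⟩ := hT2 x hm
    have := h1.ne
    have := h2.ne
    have := h1.symm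
    have := h2.symm
    have := hTC' p hp
    have := hTC' q hq
    grind
  have hzT : z ∉ T := by
    intro hm
    obtain ⟨p, hp, q, hq, hpq, h1, h2⟩ := hT2 z hm
    have := h1.ne
    have := h2.ne
    have := h1.symm
    have := h2.symm
    have := hTC' p hp
    have := hTC' q hq
    grind
  obtain ⟨v, hv⟩ := hT
  obtain ⟨p, hp, q, hq, hpq, h1, h2⟩ := hT2 v hv
  have := h1.ne
  have := h2.ne
  have := hTC' v hv
  have := hTC' p hp
  have := hTC' q hq
  grind

open Classical in
theorem aux_case_three {V : Type*} [Fintype V] (G : SimpleGraph V) {k : ℕ} (c : Fin k → ℕ)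
    (hc : ∑ i, c i = Fintype.card V) (hc2 : ∀ i, 2 ≤ c i) (hc3 : ∀ i, c i ≤ 3)
    (a b : Fin k → V) (hm : IsMatch Gᶜ a b) :
    ∃ f : V → Fin k, (∀ i, (Finset.univ.filter fun v => f v = i).card = c i) ∧
      ∀ i, (G.induce (f ⁻¹' {i})).IsAcyclic := by
  obtain ⟨ha, hb, hab, hadj⟩ := hm
  obtain ⟨f, hf1, hf2⟩ := aux_extend c hc (Fintype.card V) (fun i => {a i, b i}) (by
    intro i j v hi hj
    simp only [Finset.mem_insert, Finset.mem_singleton] at hi hj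
    rcases hi with rfl | rfl <;> rcases hj with h | h
    · exact ha h
    · exact absurd h (hab _ _)
    · exact absurd h.symm (hab _ _)
    · exact hb h) (fun i => Finset.card_le_two.trans (hc2 i)) (by omega)
  refine ⟨f, hf1, fun i => ?_⟩
  exact aux_three G f i (by rw [hf1]; exact hc3 i) (hf2 i (a i) (by simp)) (hf2 i (b i) (by simp))
    (hadj i)

open Classical in
theorem aux_case_four {V : Type*} [Fintype V] (G : SimpleGraph V) {k : ℕ} (t : Fin k)
    (hc : Fintype.card V = 3 * k + 1)
    (a b : Fin k → V) (hm : IsMatch Gᶜ a b) (x y : V) (hx : ∀ i, x ≠ a i ∧ x ≠ b i)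
    (hy : ∀ i, y ≠ a i ∧ y ≠ b i) (hxy : Gᶜ.Adj x y)
    (hxt : Gᶜ.Adj x (a t) ∨ Gᶜ.Adj x (b t)) :
    ∃ f : V → Fin k, (∀ i, (Finset.univ.filter fun v => f v = i).card = if i = t then 4 else 3) ∧
      ∀ i, (G.induce (f ⁻¹' {i})).IsAcyclic := by
  obtain ⟨ha, hb, hab, hadj⟩ := hm
  have hP : ∀ i v, v ∈ (if i = t then ({a i, b i, x, y} : Finset V) else {a i, b i}) ↔
      v = a i ∨ v = b i ∨ (i = t ∧ (v = x ∨ v = y)) := by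
    intro i v
    by_cases hi : i = t <;> simp [hi]
  obtain ⟨f, hf1, hf2⟩ := aux_extend (fun i : Fin k => if i = t then 4 else 3) (by
      rw [hc]
      have : ∀ i : Fin k, (if i = t then 4 else 3) = 3 + if i = t then 1 else 0 := by
        intro i; split_ifs <;> rfl
      simp only [this, Finset.sum_add_distrib]
      simp [mul_comm]) (Fintype.card V)
    (fun i => if i = t then ({a i, b i, x, y} : Finset V) else {a i, b i}) (by
    intro i j v hi hj
    rw [hP] at hi hj
    have h1 := hx i
    have h2 := hx j
    have h3 := hy i
    have h4 := hy j
    have h5 := hab i j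
    have h6 := hab j i
    have h7 := @ha i j
    have h8 := @hb i j
    grind) (by
      intro i
      by_cases hi : i = t
      · simp only [hi, if_true]; exact Finset.card_le_four
      · simp only [hi, if_false]; exact Finset.card_le_two.trans (by omega)) (by omega)
  simp only [hP] at hf2
  refine ⟨f, hf1, fun i => ?_⟩
  by_cases hi : i = t
  · subst hi
    have hcd : (Finset.univ.filter fun v => f v = i).card ≤ 4 := by rw [hf1]; simp
    have n1 := hx i
    have n2 := hy i
    have n3 := hab i i
    have n4 := hxy.ne
    have nadj := fun u v (h : Gᶜ.Adj u v) => ((SimpleGraph.compl_adj G u v).1 h).2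
    rcases hxt with hxt | hxt
    · refine aux_four G f i hcd (y := y) (x := x) (z := a i) (w := b i) (hf2 _ _ (by simp))
        (hf2 _ _ (by simp)) (hf2 _ _ (by simp)) (hf2 _ _ (by simp)) (nadj _ _ hxy.symm)
        (nadj _ _ hxt) (nadj _ _ (hadj i)) ?_
      rw [Finset.card_insert_of_notMem, Finset.card_insert_of_notMem, Finset.card_pair] <;> grind
    · refine aux_four G f i hcd (y := y) (x := x) (z := b i) (w := a i) (hf2 _ _ (by simp))
        (hf2 _ _ (by simp)) (hf2 _ _ (by simp)) (hf2 _ _ (by simp)) (nadj _ _ hxy.symm)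
        (nadj _ _ hxt) (nadj _ _ (hadj i).symm) ?_
      rw [Finset.card_insert_of_notMem, Finset.card_insert_of_notMem, Finset.card_pair] <;> grind
  · exact aux_three G f i (by rw [hf1]; simp [hi]) (hf2 i (a i) (by simp))
      (hf2 i (b i) (by simp)) (hadj i)

/-- If `(2/3)·n − 1 > Δ(G) ≥ (2/3)·n − 2`, then `G` admits an equitable
`⌈(Δ(G)+1)/2⌉`-tree-coloring. -/
theorem equitableTreeColoring_of_maxDegree_between_twoThirds
    {V : Type*} [Fintype V] (G : SimpleGraph V) [DecidableRel G.Adj]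
    (h1 : (G.maxDegree : ℝ) < 2 / 3 * Fintype.card V - 1)
    (h2 : (G.maxDegree : ℝ) ≥ 2 / 3 * Fintype.card V - 2) :
    G.EquitableTreeColoring ((G.maxDegree + 2) / 2) := by
  classical
  have h1' : 3 * G.maxDegree + 3 < 2 * Fintype.card V := by
    have : (3 * G.maxDegree + 3 : ℝ) < 2 * Fintype.card V := by linarith
    exact_mod_cast this
  have h2' : 2 * Fintype.card V ≤ 3 * G.maxDegree + 6 := by
    have : (2 * Fintype.card V : ℝ) ≤ 3 * G.maxDegree + 6 := by linarith
    exact_mod_cast this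
  clear h1 h2
  have hdeg : ∀ v, Fintype.card V - 1 - G.maxDegree ≤ Gᶜ.degree v := by
    intro v
    have e1 := G.degree_compl v
    have e2 := G.degree_le_maxDegree v
    have e3 : Gᶜ.degree v = Fintype.card V - 1 - G.degree v := by convert e1
    omega
  obtain ⟨k, hk⟩ : ∃ k, k = (G.maxDegree + 2) / 2 := ⟨_, rfl⟩
  rw [← hk]
  have hk1 : 1 ≤ k := by omega
  have hcases : (Fintype.card V = 3 * k ∧ k ≤ Fintype.card V - 1 - G.maxDegree) ∨
      (Fintype.card V = 3 * k - 1 ∧ k ≤ Fintype.card V - 1 - G.maxDegree) ∨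
      (Fintype.card V = 3 * k + 1 ∧ k + 1 ≤ Fintype.card V - 1 - G.maxDegree) := by omega
  unfold SimpleGraph.EquitableTreeColoring
  rcases hcases with ⟨hn, hd⟩ | ⟨hn, hd⟩ | ⟨hn, hd⟩
  · obtain ⟨a, b, hm⟩ := aux_matching Gᶜ k (fun v => (by have h3 := Nat.le_trans hd (hdeg v); convert h3)) (by omega) k le_rfl
    obtain ⟨f, hf1, hf2⟩ := aux_case_three G (fun _ : Fin k => 3) (by simp [hn, mul_comm])
      (by simp) (by simp) a b hm
    refine ⟨f, fun i => Or.inl ?_, hf2⟩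
    have hdiv : Fintype.card V / k = 3 := by
      rw [hn]; exact Nat.mul_div_cancel _ hk1
    rw [hdiv, ← hf1 i]
  · obtain ⟨a, b, hm⟩ := aux_matching Gᶜ k (fun v => (by have h3 := Nat.le_trans hd (hdeg v); convert h3)) (by omega) k le_rfl
    let t : Fin k := ⟨0, hk1⟩
    obtain ⟨f, hf1, hf2⟩ := aux_case_three G (fun i : Fin k => if i = t then 2 else 3) (by
        have e : ∑ i : Fin k, ((if i = t then 2 else 3) + if i = t then 1 else 0) = 3 * k := by
          have : ∀ i : Fin k, ((if i = t then 2 else 3) + if i = t then 1 else 0) = 3 := by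
            intro i; split_ifs <;> rfl
          simp only [this]
          simp [mul_comm]
        rw [Finset.sum_add_distrib] at e
        simp only [Finset.sum_ite_eq', Finset.mem_univ, if_true] at e
        omega)
      (by intro i; split_ifs <;> omega)
      (by intro i; split_ifs <;> omega) a b hm
    refine ⟨f, fun i => ?_, hf2⟩
    have hf := hf1 i
    by_cases hi : i = t
    · left
      have hdiv : Fintype.card V / k = 2 := by
        rw [hn, Nat.div_eq_iff (by omega)]; omega
      rw [hdiv]
      simp only [hi, if_true] at hf ⊢
      convert hf
    · right
      have hk2 : 2 ≤ k := by
        have : (i : ℕ) ≠ 0 := fun e => hi (Fin.ext e)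
        omega
      have hdiv : (Fintype.card V + k - 1) / k = 3 := by
        rw [hn, Nat.div_eq_iff (by omega)]; omega
      rw [hdiv]
      simp only [hi, if_false] at hf ⊢
      convert hf
  · obtain ⟨a, b, ha, hb, hab, hadj⟩ := aux_matching Gᶜ (k+1)
      (fun v => (by have h3 := Nat.le_trans hd (hdeg v); convert h3)) (by omega) (k+1) le_rfl
    have hm' : IsMatch Gᶜ (fun i => a (Fin.succ i)) (fun i => b (Fin.succ i)) :=
      ⟨fun i j e => Fin.succ_injective _ (ha e), fun i j e => Fin.succ_injective _ (hb e),
        fun i j => hab _ _, fun i => hadj _⟩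
    have hx : ∀ i : Fin k, a 0 ≠ a i.succ ∧ a 0 ≠ b i.succ :=
      fun i => ⟨fun e => (Fin.succ_ne_zero i) (ha e).symm, hab _ _⟩
    have hy : ∀ i : Fin k, b 0 ≠ a i.succ ∧ b 0 ≠ b i.succ :=
      fun i => ⟨(hab _ _).symm, fun e => (Fin.succ_ne_zero i) (hb e).symm⟩
    have ht : ∃ t : Fin k, Gᶜ.Adj (a 0) (a t.succ) ∨ Gᶜ.Adj (a 0) (b t.succ) := by
      by_contra! hcon
      have hsub : Gᶜ.neighborFinset (a 0) ⊆
          insert (b 0) (Finset.univ.image a ∪ Finset.univ.image b)ᶜ := by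
        intro w hw
        rw [SimpleGraph.mem_neighborFinset] at hw
        by_contra hcon2
        rw [Finset.mem_insert, not_or, Finset.mem_compl, not_not] at hcon2
        simp only [Finset.mem_union, Finset.mem_image, Finset.mem_univ, true_and] at hcon2
        obtain ⟨hw0, ⟨i, rfl⟩ | ⟨i, rfl⟩⟩ := hcon2
        · induction i using Fin.cases with
          | zero => exact hw.ne rfl
          | succ i => exact (hcon i).1 hw
        · induction i using Fin.cases with
          | zero => exact hw0 rfl
          | succ i => exact (hcon i).2 hw
      have hcd := (Finset.card_le_card hsub).trans (Finset.card_insert_le _ _)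
      have hdisj : Disjoint (Finset.univ.image a) (Finset.univ.image b) := by
        rw [Finset.disjoint_left]
        intro w h1 h2
        simp only [Finset.mem_image, Finset.mem_univ, true_and] at h1 h2
        obtain ⟨i, rfl⟩ := h1
        obtain ⟨j, hj⟩ := h2
        exact hab i j hj.symm
      rw [Finset.card_compl, Finset.card_union_of_disjoint hdisj,
        Finset.card_image_of_injective _ ha, Finset.card_image_of_injective _ hb,
        SimpleGraph.card_neighborFinset_eq_degree] at hcd
      simp only [Finset.card_univ, Fintype.card_fin] at hcd
      have := hdeg (a 0)
      omega
    obtain ⟨t, ht⟩ := ht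
    obtain ⟨f, hf1, hf2⟩ := aux_case_four G t hn _ _ hm' (a 0) (b 0) hx hy (hadj 0) ht
    refine ⟨f, fun i => ?_, hf2⟩
    have hf := hf1 i
    by_cases hi : i = t
    · right
      have hdiv : (Fintype.card V + k - 1) / k = 4 := by
        rw [hn, Nat.div_eq_iff (by omega)]; omega
      rw [hdiv]
      simp only [hi, if_true] at hf ⊢
      convert hf
    · left
      have hk2 : 2 ≤ k := by
        have : (i : ℕ) ≠ (t : ℕ) := fun e => hi (Fin.ext e)
        omega
      have hdiv : Fintype.card V / k = 3 := by
        rw [hn, Nat.div_eq_iff (by omega)]; omega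
      rw [hdiv]
      simp only [hi, if_false] at hf ⊢
      convert hf
end

section
/- Let G be a finite simple graph on n vertices with maximum degree Δ(G) satisfying (2/3)n − 2 > Δ(G) ≥ n/2. Then G admits an equitable ⌈(Δ(G)+1)/2⌉-tree-coloring; equivalently, a_eq(G) ≤ ⌈(Δ(G)+1)/2⌉. -/
namespace EqTree

open SimpleGraph

lemma pathGraph_four_isAcyclic : (pathGraph 4).IsAcyclic := by
  classical
  letI : DecidableRel (pathGraph 4).Adj := fun u v => decidable_of_iff _ pathGraph_adj.symm
  have h : (pathGraph 4).IsTree := by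
    rw [isTree_iff_connected_and_card]
    refine ⟨pathGraph_connected 3, ?_⟩
    rw [Nat.card_eq_fintype_card, Nat.card_eq_fintype_card, ← edgeFinset_card]
    decide
  exact h.isAcyclic

lemma acyclic_of_pos {V : Type*} (G : SimpleGraph V) (S : Set V) (φ : V → Fin 4)
    (hinj : ∀ u ∈ S, ∀ v ∈ S, φ u = φ v → u = v)
    (hadj : ∀ u ∈ S, ∀ v ∈ S, G.Adj u v →
      (φ u).val + 1 = (φ v).val ∨ (φ v).val + 1 = (φ u).val) :
    (G.induce S).IsAcyclic := by
  refine IsAcyclic.comap (G' := pathGraph 4)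
    ⟨fun v => φ v.1, fun {u v} h => pathGraph_adj.2 (hadj u.1 u.2 v.1 v.2 h)⟩ ?_
    pathGraph_four_isAcyclic
  intro u v h
  exact Subtype.ext (hinj u.1 u.2 v.1 v.2 h)

/-- One augmentation step. -/
lemma augment {V : Type*} [Fintype V] [DecidableEq V] (H : SimpleGraph V) [DecidableRel H.Adj]
    (d i : ℕ) (hd : ∀ v, d ≤ H.degree v) (hi : i < d) (hn : 2 * d ≤ Fintype.card V)
    (p q : Fin i → V) (hp : p.Injective) (hq : q.Injective) (hpq : ∀ a b, p a ≠ q b)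
    (hadj : ∀ a, H.Adj (p a) (q a)) :
    ∃ p q : Fin (i+1) → V, p.Injective ∧ q.Injective ∧ (∀ a b, p a ≠ q b) ∧
      ∀ a, H.Adj (p a) (q a) := by
  set M : Finset V := Finset.univ.image p ∪ Finset.univ.image q with hM
  have hMc : M.card ≤ 2 * i := by
    refine (Finset.card_union_le _ _).trans ?_
    have h1 := Finset.card_image_le (s := Finset.univ) (f := p)
    have h2 := Finset.card_image_le (s := Finset.univ) (f := q)
    simp only [Finset.card_univ, Fintype.card_fin] at h1 h2
    omega
  have hc : 1 < Mᶜ.card := by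
    rw [Finset.card_compl]; omega
  obtain ⟨u, hu, v, hv, huv⟩ := Finset.one_lt_card.1 hc
  have key : ∀ u, u ∉ M ↔ (∀ a, p a ≠ u) ∧ ∀ a, q a ≠ u := by
    intro u; simp [hM, not_or]
  -- adding a free edge
  have add : ∀ u v, u ∉ M → v ∉ M → H.Adj u v → ∃ p q : Fin (i+1) → V, p.Injective ∧
      q.Injective ∧ (∀ a b, p a ≠ q b) ∧ ∀ a, H.Adj (p a) (q a) := by
    intro u v hu hv h
    rw [key] at hu hv
    refine ⟨Fin.cons u p, Fin.cons v q, ?_, ?_, ?_, ?_⟩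
    · rw [Fin.cons_injective_iff]
      exact ⟨by rintro ⟨a, ha⟩; exact hu.1 a ha, hp⟩
    · rw [Fin.cons_injective_iff]
      exact ⟨by rintro ⟨a, ha⟩; exact hv.2 a ha, hq⟩
    · intro a b
      refine Fin.cases ?_ (fun a => ?_) a <;> refine Fin.cases ?_ (fun b => ?_) b
      · simpa using h.ne
      · simpa using (hu.2 b).symm
      · simpa using hv.1 a
      · simpa using hpq a b
    · intro a
      refine Fin.cases ?_ (fun a => ?_) a
      · simpa using h
      · simpa using hadj a
  -- replacing an edge
  have rep : ∀ u v, u ∉ M → v ∉ M → u ≠ v → ∀ a, H.Adj u (p a) → H.Adj v (q a) →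
      ∃ p q : Fin (i+1) → V, p.Injective ∧
      q.Injective ∧ (∀ a b, p a ≠ q b) ∧ ∀ a, H.Adj (p a) (q a) := by
    intro u v hu hv huv a0 h1 h2
    rw [key] at hu hv
    refine ⟨Fin.cons v p, Fin.cons (q a0) (Function.update q a0 u), ?_, ?_, ?_, ?_⟩
    · rw [Fin.cons_injective_iff]
      exact ⟨by rintro ⟨a, ha⟩; exact hv.1 a ha, hp⟩
    · rw [Fin.cons_injective_iff]
      constructor
      · rintro ⟨a, ha⟩
        by_cases h : a = a0
        · subst h; simp at ha; exact hu.2 _ ha.symm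
        · rw [Function.update_of_ne h] at ha; exact h (hq ha)
      · intro a b hab
        by_cases ha : a = a0 <;> by_cases hb : b = a0
        · rw [ha, hb]
        · subst ha; rw [Function.update_self, Function.update_of_ne hb] at hab
          exact absurd hab.symm (hu.2 b)
        · subst hb; rw [Function.update_self, Function.update_of_ne ha] at hab
          exact absurd hab (hu.2 a)
        · rw [Function.update_of_ne ha, Function.update_of_ne hb] at hab
          exact hq hab
    · intro a b
      refine Fin.cases ?_ (fun a => ?_) a <;> refine Fin.cases ?_ (fun b => ?_) b
      · simpa using (hv.2 a0).symm
      · by_cases hb : b = a0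
        · subst hb; simpa using huv.symm
        · simpa [Function.update_of_ne hb] using (hv.2 b).symm
      · simpa using hpq a a0
      · by_cases hb : b = a0
        · subst hb; simpa using hu.1 a
        · simpa [Function.update_of_ne hb] using hpq a b
    · intro a
      refine Fin.cases ?_ (fun a => ?_) a
      · simpa using h2
      · by_cases ha : a = a0
        · subst ha; simpa using h1.symm
        · simpa [Function.update_of_ne ha] using hadj a
  rw [Finset.mem_compl] at hu hv
  by_cases hfu : ∃ w, w ∉ M ∧ H.Adj u w
  · obtain ⟨w, hw, h⟩ := hfu; exact add u w hu hw h
  by_cases hfv : ∃ w, w ∉ M ∧ H.Adj v w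
  · obtain ⟨w, hw, h⟩ := hfv; exact add v w hv hw h
  push Not at hfu hfv
  have cnt : ∀ u, (∀ w, w ∉ M → ¬ H.Adj u w) →
      d ≤ ∑ a : Fin i, ((if H.Adj u (p a) then 1 else 0) + (if H.Adj u (q a) then 1 else 0)) := by
    intro u hfu
    have hsub : H.neighborFinset u ⊆ (Finset.univ.filter fun a => H.Adj u (p a)).image p ∪
        (Finset.univ.filter fun a => H.Adj u (q a)).image q := by
      intro w hw
      rw [mem_neighborFinset] at hw
      have hwM : w ∈ M := by by_contra h; exact hfu w h hw
      simp only [hM, Finset.mem_union, Finset.mem_image, Finset.mem_univ, true_and] at hwM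
      simp only [Finset.mem_union, Finset.mem_image, Finset.mem_filter, Finset.mem_univ, true_and]
      rcases hwM with ⟨a, rfl⟩ | ⟨a, rfl⟩
      · exact Or.inl ⟨a, hw, rfl⟩
      · exact Or.inr ⟨a, hw, rfl⟩
    have h1 := (Finset.card_le_card hsub).trans (Finset.card_union_le _ _)
    have h2 := Finset.card_image_le (s := Finset.univ.filter fun a => H.Adj u (p a)) (f := p)
    have h3 := Finset.card_image_le (s := Finset.univ.filter fun a => H.Adj u (q a)) (f := q)
    have h4 := hd u
    rw [card_neighborFinset_eq_degree] at h1
    rw [Finset.sum_add_distrib, ← Finset.card_filter, ← Finset.card_filter]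
    omega
  have c1 := cnt u hfu
  have c2 := cnt v hfv
  by_contra hno
  have hle : ∀ a : Fin i, ((if H.Adj u (p a) then 1 else 0) + (if H.Adj u (q a) then 1 else 0)) +
      ((if H.Adj v (p a) then 1 else 0) + (if H.Adj v (q a) then 1 else 0)) ≤ 2 := by
    intro a
    have r1 : ¬ (H.Adj u (p a) ∧ H.Adj v (q a)) := fun h => hno (rep u v hu hv huv a h.1 h.2)
    have r2 : ¬ (H.Adj v (p a) ∧ H.Adj u (q a)) := fun h => hno (rep v u hv hu huv.symm a h.1 h.2)
    split_ifs <;> first | omega | tauto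
  have hs := Finset.sum_le_sum (s := Finset.univ) (fun a _ => hle a)
  rw [Finset.sum_add_distrib] at hs
  simp only [Finset.sum_const, Finset.card_univ, Fintype.card_fin, smul_eq_mul] at hs
  omega

/-- A graph of minimum degree `≥ d` on at least `2d` vertices has a matching of size `d`. -/
lemma exists_matching {V : Type*} [Fintype V] [DecidableEq V] (H : SimpleGraph V)
    [DecidableRel H.Adj]
    (d : ℕ) (hd : ∀ v, d ≤ H.degree v) (hn : 2 * d ≤ Fintype.card V) :
    ∃ P : Fin d × Bool → V, P.Injective ∧ ∀ a b, H.Adj (P (a, b)) (P (a, !b)) := by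
  have main : ∀ i, i ≤ d → ∃ p q : Fin i → V, p.Injective ∧ q.Injective ∧ (∀ a b, p a ≠ q b) ∧
      ∀ a, H.Adj (p a) (q a) := by
    intro i
    induction i with
    | zero =>
      intro _
      exact ⟨Fin.elim0, Fin.elim0, fun a => a.elim0, fun a => a.elim0, fun a => a.elim0,
        fun a => a.elim0⟩
    | succ i ih =>
      intro hi
      obtain ⟨p, q, hp, hq, hpq, hadj⟩ := ih (by omega)
      exact augment H d i hd (by omega) hn p q hp hq hpq hadj
  obtain ⟨p, q, hp, hq, hpq, hadj⟩ := main d le_rfl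
  refine ⟨fun x => if x.2 then q x.1 else p x.1, ?_, ?_⟩
  · rintro ⟨a, b⟩ ⟨a', b'⟩ h
    cases b <;> cases b' <;> simp at h
    · rw [hp h]
    · exact absurd h (hpq _ _)
    · exact absurd h.symm (hpq _ _)
    · rw [hq h]
  · rintro a b
    cases b
    · simpa using hadj a
    · simpa using (hadj a).symm

lemma exists_extend {α β : Type*} [Fintype α] [Fintype β] [DecidableEq β] (f : α → β)
    (hf : f.Injective) (t : ℕ) (h : Fintype.card β = Fintype.card α + t) :
    ∃ w : Fin t → β, w.Injective ∧ (∀ a j, f a ≠ w j) ∧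
      ∀ b, (∃ a, f a = b) ∨ ∃ j, w j = b := by
  set S : Finset β := (Finset.univ.image f)ᶜ with hS
  have hc : S.card = t := by
    rw [hS, Finset.card_compl, Finset.card_image_of_injective _ hf, Finset.card_univ]; omega
  let e := (S.equivFinOfCardEq hc).symm
  refine ⟨fun j => (e j).1, ?_, ?_, ?_⟩
  · intro i j hij
    exact e.injective (Subtype.ext hij)
  · intro a j haj
    have := (e j).2
    simp only [hS, Finset.mem_compl, Finset.mem_image, Finset.mem_univ, true_and] at this
    exact this ⟨a, haj⟩
  · intro b
    by_cases hb : ∃ a, f a = b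
    · exact Or.inl hb
    · refine Or.inr ⟨e.symm ⟨b, ?_⟩, by simp⟩
      simpa [hS] using hb

/-- The decomposition into `r` quadruples and `t` triples. -/
lemma exists_decomp {V : Type*} [Fintype V] [DecidableEq V] (H : SimpleGraph V)
    [DecidableRel H.Adj] (r t : ℕ) (hn : Fintype.card V = 4 * r + 3 * t)
    (hd : ∀ v, 2 * r + t ≤ H.degree v) :
    ∃ g : Fin r × Fin 4 ⊕ Fin t × Fin 3 → V, g.Injective ∧
      (∀ s, H.Adj (g (.inl (s, 0))) (g (.inl (s, 2))) ∧
        H.Adj (g (.inl (s, 0))) (g (.inl (s, 3))) ∧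
        H.Adj (g (.inl (s, 1))) (g (.inl (s, 3)))) ∧
      ∀ j, H.Adj (g (.inr (j, 0))) (g (.inr (j, 2))) := by
  obtain ⟨P, hP, hPadj⟩ := exists_matching H (2 * r + t) hd (by omega)
  obtain ⟨w, hw, hPw, hcov⟩ := exists_extend P hP t (by
    simp only [Fintype.card_prod, Fintype.card_fin, Fintype.card_bool]; omega)
  classical
  let A : SimpleGraph (Fin (2 * r + t)) :=
    { Adj := fun i j => i ≠ j ∧ ∃ c d, H.Adj (P (i, c)) (P (j, d))
      symm := ⟨fun i j ⟨h, c, d, h'⟩ => ⟨h.symm, d, c, h'.symm⟩⟩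
      loopless := ⟨fun i h => h.1 rfl⟩ }
  have hA : ∀ i, r ≤ A.degree i := by
    intro i
    have hsub : H.neighborFinset (P (i, false)) ⊆ {P (i, true)} ∪ Finset.univ.image w ∪
        (A.neighborFinset i ×ˢ (Finset.univ : Finset Bool)).image P := by
      intro x hx
      rw [mem_neighborFinset] at hx
      rcases hcov x with ⟨⟨j, c⟩, rfl⟩ | ⟨j, rfl⟩
      · by_cases hij : i = j
        · subst hij
          cases c
          · exact absurd hx (H.irrefl)
          · simp
        · refine Finset.mem_union_right _ (Finset.mem_image_of_mem _ ?_)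
          simp only [Finset.mem_product, mem_neighborFinset, Finset.mem_univ, and_true]
          exact ⟨hij, _, _, hx⟩
      · simp
    have h1 := Finset.card_le_card hsub
    have h2 := Finset.card_union_le ({P (i, true)} ∪ Finset.univ.image w)
      ((A.neighborFinset i ×ˢ (Finset.univ : Finset Bool)).image P)
    have h3 := Finset.card_union_le ({P (i, true)}) (Finset.univ.image w)
    have h4 := Finset.card_image_le (s := A.neighborFinset i ×ˢ (Finset.univ : Finset Bool)) (f := P)
    have h5 := Finset.card_image_le (s := Finset.univ) (f := w)
    have h6 := hd (P (i, false))
    simp only [Finset.card_univ, Fintype.card_fin, Finset.card_singleton, Finset.card_product,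
      Fintype.card_bool, card_neighborFinset_eq_degree] at h1 h2 h3 h4 h5
    omega
  obtain ⟨Q, hQ, hQadj⟩ := exists_matching A r hA (by simp)
  obtain ⟨z, hz, hQz, -⟩ := exists_extend Q hQ t (by
    simp only [Fintype.card_prod, Fintype.card_fin, Fintype.card_bool]; omega)
  have hch : ∀ s : Fin r, ∃ c d, H.Adj (P (Q (s, false), c)) (P (Q (s, true), d)) :=
    fun s => (hQadj s false).2
  choose c d hcd using hch
  let g4 : Fin r → Fin 4 → Fin (2 * r + t) × Bool := fun s =>
    ![(Q (s, false), c s), (Q (s, true), !d s), (Q (s, false), !c s), (Q (s, true), d s)]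
  let g3 : Fin t → Fin 3 → V := fun j => ![P (z j, false), w j, P (z j, true)]
  have q1 : ∀ s s', Q (s, false) = Q (s', false) ↔ s = s' := fun s s' =>
    ⟨fun h => by simpa using hQ h, fun h => by rw [h]⟩
  have q2 : ∀ s s', Q (s, true) = Q (s', true) ↔ s = s' := fun s s' =>
    ⟨fun h => by simpa using hQ h, fun h => by rw [h]⟩
  have q3 : ∀ s s', Q (s, false) ≠ Q (s', true) := fun s s' h => by simpa using hQ h
  refine ⟨Sum.elim (fun x => P (g4 x.1 x.2)) (fun x => g3 x.1 x.2), ?_, ?_, ?_⟩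
  · refine Function.Injective.sumElim ?_ ?_ ?_
    · rintro ⟨s, i⟩ ⟨s', i'⟩ h
      have h := hP h
      fin_cases i <;> fin_cases i' <;>
        simp [g4, q1, q2, q3, (q3 _ _).symm] at h ⊢ <;> (try exact h) <;> (try exact h.1) <;>
        (obtain ⟨rfl, h⟩ := h; simp at h)
    · rintro ⟨s, i⟩ ⟨s', i'⟩ h
      fin_cases i <;> fin_cases i' <;>
        simp [g3, hP.eq_iff, hw.eq_iff, hz.eq_iff, hPw, (hPw _ _).symm] at h ⊢ <;> exact h
    · rintro ⟨s, i⟩ ⟨j, i'⟩ h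
      fin_cases i <;> fin_cases i' <;>
        simp [g4, g3, hP.eq_iff, hPw, hQz] at h
  · intro s
    refine ⟨?_, ?_, ?_⟩
    · simpa [g4] using hPadj (Q (s, false)) (c s)
    · simpa [g4] using hcd s
    · simpa [g4] using (hPadj (Q (s, true)) (d s)).symm
  · intro j
    simpa [g3] using hPadj (z j) false

end EqTree

/-- If `(2/3)·n − 2 > Δ(G) ≥ n/2`, then `G` admits an equitable
`⌈(Δ(G)+1)/2⌉`-tree-coloring. -/
theorem equitableTreeColoring_of_maxDegree_between_half_and_twoThirds
    {V : Type*} [Fintype V] (G : SimpleGraph V) [DecidableRel G.Adj]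
    (h1 : (G.maxDegree : ℝ) < 2 / 3 * Fintype.card V - 2)
    (h2 : (G.maxDegree : ℝ) ≥ Fintype.card V / 2) :
    G.EquitableTreeColoring ((G.maxDegree + 2) / 2) := by
  classical
  set n := Fintype.card V with hn
  set D := G.maxDegree with hD
  have h1' : 3 * D + 6 < 2 * n := by
    have : (3 * D + 6 : ℝ) < 2 * n := by linarith
    exact_mod_cast this
  have h2' : n ≤ 2 * D := by
    have : (n : ℝ) ≤ 2 * D := by linarith
    exact_mod_cast this
  obtain ⟨k, hk⟩ : ∃ k, k = (D + 2) / 2 := ⟨_, rfl⟩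
  rw [← hk]
  obtain ⟨r, hr⟩ : ∃ r, n = 3 * k + r := ⟨n - 3 * k, by omega⟩
  obtain ⟨t, ht⟩ : ∃ t, k = r + t := ⟨k - r, by omega⟩
  have hdeg : ∀ v, 2 * r + t ≤ Gᶜ.degree v := by
    intro v
    rw [SimpleGraph.degree_compl]
    have := G.degree_le_maxDegree v
    omega
  obtain ⟨g, hg, hg4, hg3⟩ := EqTree.exists_decomp Gᶜ r t (by omega) hdeg
  have hbij : g.Bijective := by
    rw [Fintype.bijective_iff_injective_and_card]
    refine ⟨hg, ?_⟩
    simp only [Fintype.card_sum, Fintype.card_prod, Fintype.card_fin]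
    omega
  let E := Equiv.ofBijective g hbij
  have hE : ∀ x, E x = g x := fun x => rfl
  let F : Fin r ⊕ Fin t ≃ Fin k := finSumFinEquiv.trans (finCongr ht.symm)
  let col : Fin r × Fin 4 ⊕ Fin t × Fin 3 → Fin r ⊕ Fin t := Sum.map Prod.fst Prod.fst
  have hfib : ∀ y : Fin r ⊕ Fin t, (Finset.univ.filter fun v => F (col (E.symm v)) = F y) =
      (Finset.univ.filter fun x => col x = y).map E.toEmbedding := by
    intro y
    ext v
    simp only [Finset.mem_filter, Finset.mem_univ, true_and, Finset.mem_map_equiv,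
      F.injective.eq_iff]
  have e3 : n / k = 3 := by
    rw [hr]; rw [Nat.div_eq_iff (by omega)]; constructor <;> omega
  have e4 : (n + k - 1) / k = 4 := by
    rw [hr]; rw [Nat.div_eq_iff (by omega)]; constructor <;> omega
  refine ⟨fun v => F (col (E.symm v)), ?_, ?_⟩
  · intro i
    obtain ⟨y, rfl⟩ := F.surjective i
    rw [hfib, Finset.card_map, e3, e4]
    rcases y with s | j
    · right
      have : (Finset.univ.filter fun x => col x = Sum.inl s) =
          (Finset.univ : Finset (Fin 4)).image fun a => Sum.inl (s, a) := by
        ext x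
        rcases x with ⟨a, b⟩ | ⟨a, b⟩ <;> simp [col, eq_comm]
      rw [this, Finset.card_image_of_injective _ (by intro a b h; simpa using h)]
      simp
    · left
      have : (Finset.univ.filter fun x => col x = Sum.inr j) =
          (Finset.univ : Finset (Fin 3)).image fun a => Sum.inr (j, a) := by
        ext x
        rcases x with ⟨a, b⟩ | ⟨a, b⟩ <;> simp [col, eq_comm]
      rw [this, Finset.card_image_of_injective _ (by intro a b h; simpa using h)]
      simp
  · intro i
    obtain ⟨y, rfl⟩ := F.surjective i
    let pos : Fin r × Fin 4 ⊕ Fin t × Fin 3 → Fin 4 :=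
      Sum.elim (fun x => x.2) (fun x => x.2.castSucc)
    have hS : ∀ v ∈ (fun v => F (col (E.symm v))) ⁻¹' {F y}, ∃ x, v = g x ∧ col x = y := by
      intro v hv
      refine ⟨E.symm v, ?_, ?_⟩
      · rw [← hE]; simp
      · simpa [F.injective.eq_iff] using hv
    have hgs : ∀ x, E.symm (g x) = x := fun x => by rw [← hE]; simp
    refine EqTree.acyclic_of_pos G _ (fun v => pos (E.symm v)) ?_ ?_
    · intro u hu v hv h
      obtain ⟨x, rfl, hx⟩ := hS u hu
      obtain ⟨x', rfl, hx'⟩ := hS v hv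
      simp only [hgs] at h
      rcases x with ⟨a, b⟩ | ⟨a, b⟩ <;> rcases x' with ⟨a', b'⟩ | ⟨a', b'⟩ <;>
        subst hx <;> simp [col, pos] at hx' h ⊢ <;> rw [hx', h]
    · intro u hu v hv h
      obtain ⟨x, rfl, hx⟩ := hS u hu
      obtain ⟨x', rfl, hx'⟩ := hS v hv
      simp only [hgs]
      have hne := h.ne
      rcases x with ⟨a, b⟩ | ⟨a, b⟩ <;> rcases x' with ⟨a', b'⟩ | ⟨a', b'⟩ <;>
        subst hx <;> simp [col] at hx' <;> subst hx'
      · obtain ⟨n1, n2, n3⟩ := hg4 a'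
        rw [SimpleGraph.compl_adj] at n1 n2 n3
        have n1' := n1.2; have n2' := n2.2; have n3' := n3.2
        have h' := h.symm
        fin_cases b <;> fin_cases b' <;> simp [pos] at h h' hne ⊢ <;>
          first | exact n1' h | exact n2' h | exact n3' h | exact n1' h' | exact n2' h' | exact n3' h'
      · have n1 := hg3 a'
        rw [SimpleGraph.compl_adj] at n1
        have n1' := n1.2
        have h' := h.symm
        fin_cases b <;> fin_cases b' <;> simp [pos] at h h' hne ⊢ <;>
          first | exact n1' h | exact n1' h'
end

section
/- If G is a finite simple graph that is disconnected (has more than one connected component), then G has a matching of size at least δ(G), i.e., α'(G) ≥ δ(G). -/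
/-- If `G` is disconnected (it has more than one connected component, i.e. some pair of
vertices is not joined by a walk), then `G` has a matching of size at least `δ(G)`. -/
theorem exists_matching_of_disconnected
    {V : Type*} [Fintype V] (G : SimpleGraph V) [DecidableRel G.Adj]
    (hd : ¬ G.Preconnected) :
    ∃ M : G.Subgraph, M.IsMatching ∧ G.minDegree ≤ M.edgeSet.ncard := by
  classical
  -- a matching is encoded as an involution moving vertices only along edges
  let P : (V → V) → Prop := fun f => ∀ x, f (f x) = x ∧ (f x = x ∨ G.Adj x (f x))
  let S : (V → V) → Finset V := fun f => Finset.univ.filter (fun x => f x ≠ x)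
  have hne : Nonempty {f : V → V // P f} := ⟨⟨id, fun x => ⟨rfl, Or.inl rfl⟩⟩⟩
  obtain ⟨⟨f, hf⟩, hmax⟩ := Finite.exists_max (fun f : {f : V → V // P f} => (S f.1).card)
  have hmax' : ∀ g, P g → (∀ z, f z ≠ z → g z ≠ z) → ∀ z, g z ≠ z → f z ≠ z := by
    intro g hg hsub z hz hz'
    have h1 := hmax ⟨g, hg⟩
    have h2 : S f ⊂ S g := by
      rw [Finset.ssubset_iff_of_subset (by intro z; simpa [S] using hsub z)]
      exact ⟨z, by simpa [S] using hz, by simpa [S] using hz'⟩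
    have := Finset.card_lt_card h2
    simp only at h1
    omega
  have hn : 2 * G.minDegree + 2 ≤ Fintype.card V := by
    simp only [SimpleGraph.Preconnected, not_forall] at hd
    obtain ⟨a, b, hab⟩ := hd
    have hdis : Disjoint (insert a (G.neighborFinset a)) (insert b (G.neighborFinset b)) := by
      rw [Finset.disjoint_left]
      intro z hz hz'
      apply hab
      have h1 : G.Reachable a z := by
        rcases Finset.mem_insert.1 hz with rfl | h
        · rfl
        · exact ((G.mem_neighborFinset _ _).1 h).reachable
      have h2 : G.Reachable b z := by
        rcases Finset.mem_insert.1 hz' with rfl | h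
        · rfl
        · exact ((G.mem_neighborFinset _ _).1 h).reachable
      exact h1.trans h2.symm
    have h := Finset.card_le_univ (insert a (G.neighborFinset a) ∪ insert b (G.neighborFinset b))
    rw [Finset.card_union_of_disjoint hdis, Finset.card_insert_of_notMem (by simp),
      Finset.card_insert_of_notMem (by simp), G.card_neighborFinset_eq_degree,
      G.card_neighborFinset_eq_degree] at h
    have := G.minDegree_le_degree a
    have := G.minDegree_le_degree b
    omega
  -- fixed points are independent
  have hind : ∀ u x, f u = u → G.Adj u x → f x ≠ x := by
    intro u x hu hux hx
    have hne := hux.ne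
    have hxu := hux.symm
    refine hmax' (fun z => if z = u then x else if z = x then u else f z) ?_ ?_ u ?_ hu
    · intro z
      have := hf z
      grind
    · intro z hz
      grind
    · grind
  have haug : ∀ u v x, f u = u → f v = v → u ≠ v → G.Adj u x → ¬ G.Adj v (f x) := by
    intro u v x hu hv huv hux hvy
    have hx := hind u x hu hux
    have hfx := hf x
    have h1 := hux.ne
    have h2 := hvy.ne
    have h3 := hux.symm
    have h4 := hvy.symm
    refine hmax' (fun z => if z = u then x else if z = x then u else if z = v then f x else
      if z = f x then v else f z) ?_ ?_ u ?_ hu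
    · intro z
      have := hf z
      grind
    · intro z hz
      grind
    · grind
  have hS : 2 * G.minDegree ≤ (S f).card := by
    by_cases h : 1 < (Finset.univ.filter (fun x => f x = x)).card
    · obtain ⟨u, hu, v, hv, huv⟩ := Finset.one_lt_card.1 h
      simp only [Finset.mem_filter, Finset.mem_univ, true_and] at hu hv
      have hinj : Function.Injective f := fun x y hxy => by
        rw [← (hf x).1, hxy, (hf y).1]
      have hdis : Disjoint ((G.neighborFinset u).image f) (G.neighborFinset v) := by
        rw [Finset.disjoint_left]
        intro z hz hz'
        obtain ⟨x, hx, rfl⟩ := Finset.mem_image.1 hz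
        exact haug u v x hu hv huv ((G.mem_neighborFinset _ _).1 hx)
          ((G.mem_neighborFinset _ _).1 hz')
      have hsub : (G.neighborFinset u).image f ∪ G.neighborFinset v ⊆ S f := by
        intro z hz
        rcases Finset.mem_union.1 hz with hz | hz
        · obtain ⟨x, hx, rfl⟩ := Finset.mem_image.1 hz
          have := hind u x hu ((G.mem_neighborFinset _ _).1 hx)
          simp only [S, Finset.mem_filter, Finset.mem_univ, true_and]
          exact fun h => this (hinj h)
        · have := hind v z hv ((G.mem_neighborFinset _ _).1 hz)
          simpa [S] using this
      have h := Finset.card_le_card hsub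
      rw [Finset.card_union_of_disjoint hdis, Finset.card_image_of_injective _ hinj,
        G.card_neighborFinset_eq_degree, G.card_neighborFinset_eq_degree] at h
      have := G.minDegree_le_degree u
      have := G.minDegree_le_degree v
      omega
    · have := Finset.card_filter_add_card_filter_not (s := (Finset.univ : Finset V))
        (fun x => f x = x)
      rw [Finset.card_univ] at this
      simp only [S, ne_eq]
      omega
  let M : G.Subgraph :=
    { verts := {x | f x ≠ x}
      Adj := fun a b => f a = b ∧ a ≠ b
      adj_sub := by
        intro a b h
        have := hf a
        grind
      edge_vert := by
        intro a b h
        have := hf a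
        simp only [Set.mem_setOf_eq]
        grind
      symm := ⟨by
        intro a b h
        have := hf a
        grind⟩ }
  refine ⟨M, ?_, ?_⟩
  · intro a ha
    exact ⟨f a, ⟨rfl, fun h => ha h.symm⟩, fun y hy => hy.1.symm⟩
  · have hcov : S f ⊆ M.edgeSet.toFinset.biUnion (fun e => e.toFinset) := by
      intro x hx
      have hx' : f x ≠ x := by simpa [S] using hx
      rw [Finset.mem_biUnion]
      refine ⟨s(x, f x), ?_, by simp⟩
      rw [Set.mem_toFinset, SimpleGraph.Subgraph.mem_edgeSet]
      exact ⟨rfl, hx'.symm⟩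
    have h1 := Finset.card_le_card hcov
    have h2 := Finset.card_biUnion_le_card_mul M.edgeSet.toFinset (fun e => e.toFinset) 2 (by
      intro e _
      rw [Sym2.card_toFinset]
      split_ifs <;> omega)
    rw [Set.ncard_eq_toFinset_card']
    omega
end

section
/- If G is a finite simple connected graph on n vertices with n > 2·δ(G), then G has a matching of size at least δ(G), i.e., α'(G) ≥ δ(G). -/
/-- If `G` is a connected graph on `n > 2·δ(G)` vertices, then `G` has a matching of size
at least `δ(G)`. -/
theorem exists_matching_of_connected_of_two_mul_minDegree_lt
    {V : Type*} [Fintype V] (G : SimpleGraph V) [DecidableRel G.Adj]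
    (hc : G.Connected) (hn : 2 * G.minDegree < Fintype.card V) :
    ∃ M : G.Subgraph, M.IsMatching ∧ G.minDegree ≤ M.edgeSet.ncard := by
  classical
  -- matchings are encoded as involutions moving vertices only along edges
  let P : (V → V) → Prop := fun f => (∀ v, f (f v) = v) ∧ ∀ v, f v ≠ v → G.Adj v (f v)
  let S : (V → V) → Finset V := fun f => Finset.univ.filter fun v => f v ≠ v
  haveI : Nonempty {f // P f} := ⟨⟨id, by simp [P]⟩⟩
  obtain ⟨⟨f, hf⟩, hmax⟩ := Finite.exists_max (fun f : {f // P f} => (S f.1).card)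
  obtain ⟨hinv, hadj⟩ := hf
  have hmax' : ∀ g, P g → ∀ u, f u = u → g u ≠ u → (∀ v, f v ≠ v → g v ≠ v) → False := by
    intro g hg u hu hgu hsub
    have h1 := hmax ⟨g, hg⟩
    have h2 : S f ⊂ S g := by
      rw [Finset.ssubset_iff_of_subset]
      · exact ⟨u, by simpa [S] using hgu, by simpa [S] using hu⟩
      · intro v hv
        simp only [S, Finset.mem_filter, Finset.mem_univ, true_and] at hv ⊢
        exact hsub v hv
    exact absurd (Finset.card_lt_card h2) (not_lt.mpr h1)
  have hcard : 2 * G.minDegree ≤ (S f).card := by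
    by_cases h2 : ∃ u w, u ≠ w ∧ f u = u ∧ f w = w
    · obtain ⟨u, w, huw, hu, hw⟩ := h2
      -- neighbours of unmatched vertices are matched
      have hnb : ∀ a b, f a = a → G.Adj a b → f b ≠ b := by
        intro a b ha hab hb
        have hne := hab.ne
        have hba := hab.symm
        refine hmax' (fun v => if v = a then b else if v = b then a else f v) ⟨?_, ?_⟩ a ha ?_ ?_
        · intro v
          have := hinv v
          grind
        · intro v
          have := hadj v
          grind
        · grind
        · intro v
          grind
      -- no augmenting path of length three
      have haug : ∀ x, G.Adj u x → ¬ G.Adj w (f x) := by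
        intro x hux hwx
        have hx := hnb u x hu hux
        have hxx := hinv x
        have hxu := hux.symm
        have hxw := hwx.symm
        refine hmax' (fun v => if v = u then x else if v = x then u else
          if v = w then f x else if v = f x then w else f v) ⟨?_, ?_⟩ u hu ?_ ?_
        · intro v
          have := hinv v
          grind
        · intro v
          have := hadj v
          grind
        · have := hux.ne
          grind
        · intro v
          grind
      have hdisj : Disjoint (G.neighborFinset u) ((G.neighborFinset w).image f) := by
        rw [Finset.disjoint_left]
        intro x hx hx'
        rw [Finset.mem_image] at hx'
        obtain ⟨y, hy, rfl⟩ := hx'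
        rw [SimpleGraph.mem_neighborFinset] at hx hy
        exact haug _ hx (by rwa [hinv])
      have hsub : G.neighborFinset u ∪ (G.neighborFinset w).image f ⊆ S f := by
        intro x hx
        simp only [S, Finset.mem_filter, Finset.mem_univ, true_and]
        rw [Finset.mem_union, Finset.mem_image] at hx
        rcases hx with hx | ⟨y, hy, rfl⟩
        · rw [SimpleGraph.mem_neighborFinset] at hx
          exact hnb u x hu hx
        · rw [SimpleGraph.mem_neighborFinset] at hy
          rw [hinv]
          exact (hnb w y hw hy).symm
      have h3 := Finset.card_le_card hsub
      have hinj : Function.Injective f := Function.LeftInverse.injective hinv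
      rw [Finset.card_union_of_disjoint hdisj, Finset.card_image_of_injective _ hinj,
        SimpleGraph.card_neighborFinset_eq_degree, SimpleGraph.card_neighborFinset_eq_degree] at h3
      have := G.minDegree_le_degree u
      have := G.minDegree_le_degree w
      omega
    · have h4 : (Finset.univ.filter fun v => ¬ f v ≠ v).card ≤ 1 := by
        rw [Finset.card_le_one]
        intro a ha b hb
        by_contra hab
        exact h2 ⟨a, b, hab, by simpa using ha, by simpa using hb⟩
      have h5 := Finset.card_filter_add_card_filter_not (s := Finset.univ) (fun v => f v ≠ v)
      rw [Finset.card_univ] at h5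
      change _ ≤ (Finset.univ.filter fun v => f v ≠ v).card
      omega
  let M : G.Subgraph :=
    { verts := {v | f v ≠ v}
      Adj := fun v w => f v ≠ v ∧ f v = w
      adj_sub := by
        rintro v w ⟨h, rfl⟩
        exact hadj v h
      edge_vert := fun h => h.1
      symm := ⟨by
        rintro v w ⟨h, rfl⟩
        exact ⟨by rw [hinv]; exact h.symm, hinv v⟩⟩ }
  refine ⟨M, ?_, ?_⟩
  · intro v hv
    exact ⟨f v, ⟨hv, rfl⟩, fun y hy => hy.2.symm⟩
  · have h6 : (S f).card ≤ 2 * ((S f).image fun v => s(v, f v)).card := by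
      apply Finset.card_le_mul_card_image
      intro e he
      rw [Finset.mem_image] at he
      obtain ⟨v, hv, rfl⟩ := he
      refine (Finset.card_le_card (t := {v, f v}) ?_).trans Finset.card_le_two
      intro x hx
      simp only [Finset.mem_filter, Sym2.eq_iff] at hx
      simp only [Finset.mem_insert, Finset.mem_singleton]
      tauto
    have h7 : ((S f).image fun v => s(v, f v)).card ≤ M.edgeSet.ncard := by
      rw [← Set.ncard_coe_finset]
      refine Set.ncard_le_ncard ?_ (Set.toFinite _)
      intro e he
      rw [Finset.mem_coe, Finset.mem_image] at he
      obtain ⟨v, hv, rfl⟩ := he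
      rw [SimpleGraph.Subgraph.mem_edgeSet]
      exact ⟨by simpa [S] using hv, rfl⟩
    omega
end

section
/- If G is a finite simple connected graph on n vertices with n > 2·δ(G), then G contains a path on 2·δ(G) + 1 distinct vertices (i.e., a path of length 2·δ(G)). -/
/-- A vertex adjacent to a cyclically closed list can be attached to give a longer path. -/
lemma extend_cycle {V : Type*} (G : SimpleGraph V) (C : List V) (hC : C.IsChain G.Adj)
    (hnd : C.Nodup) (hcl : ∀ a ∈ C.getLast?, ∀ b ∈ C.head?, G.Adj a b)
    (x y : V) (hx : x ∈ C) (hy : y ∉ C) (hxy : G.Adj x y) :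
    ∃ l : List V, l.IsChain G.Adj ∧ l.Nodup ∧ l.length = C.length + 1 := by
  obtain ⟨P, Q, rfl⟩ := List.append_of_mem hx
  refine ⟨y :: ((x :: Q) ++ P), ?_, ?_, ?_⟩
  · rw [List.isChain_cons]
    refine ⟨by simpa using hxy.symm, ?_⟩
    rw [List.isChain_append] at hC ⊢
    refine ⟨hC.2.1, hC.1, ?_⟩
    intro a ha b hb
    apply hcl a _ b _
    · rw [List.getLast?_append_of_ne_nil _ (by simp)]; exact ha
    · cases P with
      | nil => simp at hb
      | cons p P => simpa using hb
  · rw [List.nodup_cons]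
    refine ⟨?_, List.nodup_append_comm.1 hnd⟩
    intro h
    apply hy
    simp only [List.mem_append] at h ⊢
    exact h.symm
  · simp; omega

/-- Pósa/Dirac crossing: if all neighbours of both ends lie on a short path, there is a crossing. -/
lemma exists_crossing {V : Type*} [Fintype V] (G : SimpleGraph V) [DecidableRel G.Adj]
    (l : List V) (k : ℕ) (hl : l.length = k + 1) (hk : k < 2 * G.minDegree)
    (a b : V) (ha : l[0]? = some a) (hb : l[k]? = some b)
    (hNa : ∀ y, G.Adj a y → y ∈ l) (hNb : ∀ y, G.Adj b y → y ∈ l) :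
    ∃ i < k, ∃ c d : V, l[i]? = some c ∧ l[i + 1]? = some d ∧ G.Adj a d ∧ G.Adj b c := by
  classical
  let f : ℕ → V := fun i => l.getD i a
  have hf : ∀ i (h : i < l.length), f i = l[i] := by
    intro i h; simp [f, h]
  let S := (Finset.range k).filter (fun i => G.Adj a (f (i + 1)))
  let T := (Finset.range k).filter (fun i => G.Adj b (f i))
  have hS : G.minDegree ≤ S.card := by
    refine (G.minDegree_le_degree a).trans ?_
    rw [← G.card_neighborFinset_eq_degree]
    refine (Finset.card_le_card (t := S.image (fun i => f (i + 1))) ?_).trans Finset.card_image_le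
    intro y hy
    rw [SimpleGraph.mem_neighborFinset] at hy
    obtain ⟨j, hj, rfl⟩ := List.mem_iff_getElem.1 (hNa y hy)
    cases j with
    | zero => 
      rw [List.getElem?_eq_getElem hj] at ha
      simp only [Option.some.injEq] at ha
      rw [ha] at hy
      exact (G.irrefl hy).elim
    | succ j =>
      simp only [Finset.mem_image, S, Finset.mem_filter, Finset.mem_range]
      exact ⟨j, ⟨by omega, by rwa [hf _ hj]⟩, hf _ hj⟩
  have hT : G.minDegree ≤ T.card := by
    refine (G.minDegree_le_degree b).trans ?_
    rw [← G.card_neighborFinset_eq_degree]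
    refine (Finset.card_le_card (t := T.image f) ?_).trans Finset.card_image_le
    intro y hy
    rw [SimpleGraph.mem_neighborFinset] at hy
    obtain ⟨j, hj, rfl⟩ := List.mem_iff_getElem.1 (hNb y hy)
    by_cases hjk : j = k
    · subst hjk
      rw [List.getElem?_eq_getElem hj] at hb
      simp only [Option.some.injEq] at hb
      rw [hb] at hy
      exact (G.irrefl hy).elim
    · simp only [Finset.mem_image, T, Finset.mem_filter, Finset.mem_range]
      exact ⟨j, ⟨by omega, by rwa [hf _ hj]⟩, hf _ hj⟩
  have hne : (S ∩ T).Nonempty := by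
    rw [← Finset.card_pos]
    have h1 := Finset.card_union_add_card_inter S T
    have h2 : (S ∪ T).card ≤ k := by
      have : S ∪ T ⊆ Finset.range k :=
        Finset.union_subset (Finset.filter_subset _ _) (Finset.filter_subset _ _)
      simpa using Finset.card_le_card this
    omega
  obtain ⟨i, hi⟩ := hne
  simp only [Finset.mem_inter, S, T, Finset.mem_filter, Finset.mem_range] at hi
  obtain ⟨⟨hik, h1⟩, -, h2⟩ := hi
  have hi0 : i < l.length := by omega
  have hi1 : i + 1 < l.length := by omega
  rw [hf _ hi1] at h1
  rw [hf _ hi0] at h2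
  exact ⟨i, hik, l[i], l[i + 1], List.getElem?_eq_getElem hi0, List.getElem?_eq_getElem hi1, h1, h2⟩

/-- One extension step. -/
lemma extend_step {V : Type*} [Fintype V] (G : SimpleGraph V) [DecidableRel G.Adj]
    (hc : G.Connected) (hn : 2 * G.minDegree < Fintype.card V)
    (l : List V) (k : ℕ) (hl : l.length = k + 1) (hk : k < 2 * G.minDegree)
    (hch : l.IsChain G.Adj) (hnd : l.Nodup) :
    ∃ l' : List V, l'.IsChain G.Adj ∧ l'.Nodup ∧ l'.length = l.length + 1 := by
  classical
  have ha : l[0]? = some l[0] := List.getElem?_eq_getElem (by omega)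
  have hb : l[k]? = some l[k] := List.getElem?_eq_getElem (by omega)
  have hhead : l.head? = some l[0] := by rw [List.head?_eq_getElem?, ha]
  have hlast : l.getLast? = some l[k] := by
    rw [List.getLast?_eq_getElem?, show l.length - 1 = k by omega, hb]
  generalize l[0] = a at ha hhead
  generalize l[k] = b at hb hlast
  by_cases hNa : ∀ y, G.Adj a y → y ∈ l
  swap
  · push Not at hNa
    obtain ⟨y, hy, hyl⟩ := hNa
    refine ⟨y :: l, ?_, List.nodup_cons.2 ⟨hyl, hnd⟩, by simp⟩
    rw [List.isChain_cons]
    refine ⟨?_, hch⟩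
    simpa [hhead] using hy.symm
  by_cases hNb : ∀ y, G.Adj b y → y ∈ l
  swap
  · push Not at hNb
    obtain ⟨y, hy, hyl⟩ := hNb
    refine ⟨y :: l.reverse, ?_, List.nodup_cons.2 ⟨by simpa using hyl, by simpa using hnd⟩, by simp⟩
    rw [List.isChain_cons]
    refine ⟨?_, ?_⟩
    · simpa [hlast] using hy.symm
    · rw [List.isChain_reverse]
      exact hch.imp fun _ _ h => h.symm
  obtain ⟨i, hik, c, d, hic, hid, had, hbc⟩ := exists_crossing G l k hl hk a b ha hb hNa hNb
  have hperm : (l.take (i + 1) ++ (l.drop (i + 1)).reverse).Perm l := by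
    refine ((List.reverse_perm _).append_left _).trans ?_
    rw [List.take_append_drop]
  obtain ⟨z, hz⟩ : ∃ z, z ∉ l := by
    by_contra h
    push Not at h
    have h1 : l.toFinset = Finset.univ := by ext v; simp [h v]
    have h2 := List.toFinset_card_le l
    rw [h1, Finset.card_univ] at h2
    omega
  have hal : a ∈ l := List.mem_of_getElem? ha
  obtain ⟨p⟩ := hc.preconnected a z
  obtain ⟨e, -, he1, he2⟩ := p.exists_boundary_dart {v | v ∈ l} hal hz
  rw [← hperm.length_eq]
  refine extend_cycle G _ ?_ (hperm.nodup_iff.2 hnd) ?_ e.fst e.snd (hperm.mem_iff.2 he1)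
    (fun h => he2 (hperm.mem_iff.1 h)) e.adj
  · rw [List.isChain_append]
    refine ⟨hch.take _, ?_, ?_⟩
    · rw [List.isChain_reverse]
      exact (hch.drop _).imp fun _ _ h => h.symm
    · intro x hx y hy
      rw [List.getLast?_take] at hx
      rw [List.head?_reverse, List.getLast?_drop, if_neg (by omega), hlast] at hy
      simp [hic] at hx hy
      subst hx hy
      exact hbc.symm
  · have hne : (l.drop (i + 1)).reverse ≠ [] := by
      intro h
      have := congrArg List.length h
      simp at this
      omega
    have hne' : l.take (i + 1) ≠ [] := by
      intro h
      have := congrArg List.length h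
      rw [List.length_take, List.length_nil] at this
      omega
    rw [List.getLast?_append_of_ne_nil _ hne, List.getLast?_reverse, List.head?_drop, hid,
      List.head?_append_of_ne_nil _ hne',
      List.head?_take, hhead]
    intro x hx y hy
    simp at hx hy
    subst hx hy
    exact had.symm

/-- If `G` is a connected graph on `n > 2·δ(G)` vertices, then `G` contains a path of
length `2·δ(G)` (i.e. on `2·δ(G) + 1` distinct vertices). -/
theorem exists_path_of_connected_of_two_mul_minDegree_lt
    {V : Type*} [Fintype V] (G : SimpleGraph V) [DecidableRel G.Adj]
    (hc : G.Connected) (hn : 2 * G.minDegree < Fintype.card V) :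
    ∃ (u v : V) (p : G.Walk u v), p.IsPath ∧ p.length = 2 * G.minDegree := by
  have key : ∀ k ≤ 2 * G.minDegree,
      ∃ l : List V, l.IsChain G.Adj ∧ l.Nodup ∧ l.length = k + 1 := by
    intro k
    induction k with
    | zero =>
      intro _
      obtain ⟨v⟩ := hc.nonempty
      exact ⟨[v], by simp, by simp, by simp⟩
    | succ k ih =>
      intro hk
      obtain ⟨l, h1, h2, h3⟩ := ih (by omega)
      obtain ⟨l', h1', h2', h3'⟩ := extend_step G hc hn l k h3 (by omega) h1 h2
      exact ⟨l', h1', h2', by omega⟩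
  obtain ⟨l, h1, h2, h3⟩ := key _ le_rfl
  have hne : l ≠ [] := by rintro rfl; simp at h3
  refine ⟨_, _, SimpleGraph.Walk.ofSupport l hne h1, ?_, ?_⟩
  · rw [SimpleGraph.Walk.isPath_def, SimpleGraph.Walk.support_ofSupport]
    exact h2
  · rw [SimpleGraph.Walk.length_ofSupport]; omega
end

section
/- Let G be a finite simple graph on n vertices with maximum degree Δ(G) ≥ n/2. Then the vertex set of G can be equitably partitioned into ⌈(Δ(G)+1)/2⌉ subsets (each of size ⌈n/k⌉ or ⌊n/k⌋ where k = ⌈(Δ(G)+1)/2⌉) such that each subset induces a linear forest of G, i.e., an acyclic subgraph in which every vertex has degree at most 2. -/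
lemma elf_acyclic_of_rank {W : Type*} (G : SimpleGraph W) (r : W → ℕ)
    (hr : Function.Injective r)
    (h : ∀ u v, G.Adj u v → r u = r v + 1 ∨ r v = r u + 1) : G.IsAcyclic := by
  classical
  intro v c hc
  obtain ⟨u, hu, hmax⟩ := Finset.exists_max_image c.support.toFinset r ⟨v, by simp⟩
  have hu' : u ∈ c.support := by simpa using hu
  have hc' := hc.rotate hu'
  set d := c.rotate u hu' with hd
  have hmem : ∀ x ∈ d.support, r x ≤ r u := by
    intro x hx
    apply hmax
    simpa [hd] using hx
  have h1 := d.adj_snd hc'.not_nil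
  have h2 := d.adj_penultimate hc'.not_nil
  have m1 : r d.snd ≤ r u := hmem _ (d.getVert_mem_support 1)
  have m2 : r d.penultimate ≤ r u := hmem _ (d.getVert_mem_support (d.length - 1))
  apply hc'.snd_ne_penultimate
  apply hr
  rcases h _ _ h1 with h1 | h1 <;> rcases h _ _ h2 with h2 | h2 <;> omega

/-- `T` has an injective rank such that adjacent vertices have consecutive ranks. -/
def ElfLin {V : Type*} (G : SimpleGraph V) (T : Set V) : Prop :=
  ∃ r : V → ℕ, Set.InjOn r T ∧
    ∀ u ∈ T, ∀ v ∈ T, G.Adj u v → r u = r v + 1 ∨ r v = r u + 1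

lemma ElfLin.acyclic {V : Type*} {G : SimpleGraph V} {T : Set V} (h : ElfLin G T) :
    (G.induce T).IsAcyclic := by
  obtain ⟨r, hr, h⟩ := h
  apply elf_acyclic_of_rank _ (fun x => r x.1)
  · intro x y hxy
    exact Subtype.ext (hr x.2 y.2 hxy)
  · intro u v huv
    exact h u u.2 v v.2 (by simpa using huv)

lemma ElfLin.deg {V : Type*} {G : SimpleGraph V} {T : Set V} (h : ElfLin G T)
    (v : V) (hv : v ∈ T) : ({w | w ∈ T ∧ G.Adj v w}).ncard ≤ 2 := by
  obtain ⟨r, hr, h⟩ := h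
  have hsub : ∀ w ∈ {w | w ∈ T ∧ G.Adj v w}, r w ∈ (({r v + 1, r v - 1} : Finset ℕ) : Set ℕ) := by
    rintro w ⟨hw, ha⟩
    have := h v hv w hw ha
    simp
    omega
  calc _ ≤ (({r v + 1, r v - 1} : Finset ℕ) : Set ℕ).ncard :=
        Set.ncard_le_ncard_of_injOn r hsub (fun x hx y hy => hr hx.1 hy.1)
    _ ≤ 2 := by
        rw [Set.ncard_coe_finset]
        exact Finset.card_le_two

lemma elfLin_of_card_le_two {V : Type*} [DecidableEq V] (G : SimpleGraph V) (T : Finset V)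
    (hT : T.card ≤ 2) : ElfLin G (T : Set V) := by
  rcases T.eq_empty_or_nonempty with rfl | ⟨x, hx⟩
  · exact ⟨fun _ => 0, by simp, by simp⟩
  have hc : (T.erase x).card ≤ 1 := by rw [Finset.card_erase_of_mem hx]; omega
  rw [Finset.card_le_one] at hc
  simp only [Finset.mem_erase] at hc
  refine ⟨fun v => if v = x then 0 else 1, ?_, ?_⟩
  · intro u hu v hv huv
    simp only [Finset.mem_coe] at hu hv
    have := hc u
    grind
  · intro u hu v hv huv
    have := huv.ne
    simp only [Finset.mem_coe] at hu hv
    have := hc u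
    grind

lemma elfLin_of_card_le_three {V : Type*} [DecidableEq V] (G : SimpleGraph V) (T : Finset V)
    (hT : T.card ≤ 3) (x y : V) (hx : x ∈ T) (hy : y ∈ T) (hxy : x ≠ y) (ha : ¬ G.Adj x y) :
    ElfLin G (T : Set V) := by
  have hc : ((T.erase x).erase y).card ≤ 1 := by
    rw [Finset.card_erase_of_mem (by simp [hy, hxy.symm]), Finset.card_erase_of_mem hx]; omega
  rw [Finset.card_le_one] at hc
  simp only [Finset.mem_erase] at hc
  have ha' : ¬ G.Adj y x := fun h => ha h.symm
  refine ⟨fun v => if v = x then 0 else if v = y then 2 else 1, ?_, ?_⟩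
  · intro u hu v hv huv
    simp only [Finset.mem_coe] at hu hv
    have := hc u
    grind
  · intro u hu v hv huv
    have := huv.ne
    simp only [Finset.mem_coe] at hu hv
    have := hc u
    grind

lemma elfLin_of_card_le_four {V : Type*} [DecidableEq V] (G : SimpleGraph V) (T : Finset V)
    (hT : T.card ≤ 4) (x y z w : V) (hnd : [x, y, z, w].Nodup)
    (hsub : ∀ v ∈ [x, y, z, w], v ∈ T)
    (h1 : ¬ G.Adj x y) (h2 : ¬ G.Adj y z) (h3 : ¬ G.Adj z w) :
    ElfLin G (T : Set V) := by
  have hT' : [x, y, z, w].toFinset = T := by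
    apply Finset.eq_of_subset_of_card_le
    · intro v hv
      exact hsub v (by simpa using hv)
    · rw [List.toFinset_card_of_nodup hnd]; simpa using hT
  have h1' : ¬ G.Adj y x := fun h => h1 h.symm
  have h2' : ¬ G.Adj z y := fun h => h2 h.symm
  have h3' : ¬ G.Adj w z := fun h => h3 h.symm
  simp only [List.nodup_cons, List.mem_cons, List.not_mem_nil] at hnd
  have hm : ∀ v ∈ T, v = x ∨ v = y ∨ v = z ∨ v = w := by
    intro v hv
    rw [← hT'] at hv
    simpa using hv
  refine ⟨fun v => if v = z then 0 else if v = x then 1 else if v = w then 2 else 3, ?_, ?_⟩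
  · intro u hu v hv huv
    have := hm u hu
    have := hm v hv
    grind
  · intro u hu v hv huv
    have := huv.ne
    rcases hm u hu with rfl | rfl | rfl | rfl <;> rcases hm v hv with rfl | rfl | rfl | rfl <;> grind

lemma elf_extend {V : Type*} [Fintype V] [DecidableEq V] {k : ℕ} (s : Fin k → ℕ)
    (hs : ∑ i, s i = Fintype.card V) :
    ∀ (m : ℕ) (S : Fin k → Finset V), (∀ i j, i ≠ j → Disjoint (S i) (S j)) →
      (∀ i, (S i).card ≤ s i) → ∑ i, (S i).card + m = Fintype.card V →
      ∃ f : V → Fin k, (∀ i, ∀ v ∈ S i, f v = i) ∧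
        ∀ i, (Finset.univ.filter fun v => f v = i).card = s i := by
  intro m
  induction m with
  | zero =>
    intro S hd hc hm
    have heq : ∀ i, (S i).card = s i := by
      have := (Finset.sum_eq_sum_iff_of_le (s := Finset.univ) (fun i _ => hc i)).1 (by omega)
      exact fun i => this i (Finset.mem_univ i)
    have hU : Finset.univ.biUnion S = Finset.univ := by
      rw [← Finset.card_eq_iff_eq_univ, Finset.card_biUnion (fun i _ j _ hij => hd i j hij)]
      omega
    have hex : ∀ v, ∃ i, v ∈ S i := by
      intro v
      have : v ∈ Finset.univ.biUnion S := by rw [hU]; simp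
      simpa using this
    choose f hf using hex
    have huniq : ∀ i, ∀ v ∈ S i, f v = i := by
      intro i v hv
      by_contra hne
      exact Finset.disjoint_left.1 (hd _ _ hne) (hf v) hv
    refine ⟨f, huniq, fun i => ?_⟩
    rw [← heq i]
    congr 1
    ext v
    simp only [Finset.mem_filter, Finset.mem_univ, true_and]
    exact ⟨fun h => h ▸ hf v, huniq i v⟩
  | succ m ih =>
    intro S hd hc hm
    have hlt : ∑ i, (S i).card < ∑ i, s i := by omega
    obtain ⟨i, -, hi⟩ := Finset.exists_lt_of_sum_lt hlt
    have hU : ∃ v, v ∉ Finset.univ.biUnion S := by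
      by_contra hcon
      push Not at hcon
      have h1 : Finset.univ.biUnion S = Finset.univ := Finset.eq_univ_iff_forall.2 hcon
      have h2 := Finset.card_biUnion (s := Finset.univ) (t := S) (fun i _ j _ hij => hd i j hij)
      rw [h1, Finset.card_univ] at h2
      omega
    obtain ⟨v, hv⟩ := hU
    simp only [Finset.mem_biUnion, Finset.mem_univ, true_and, not_exists] at hv
    have g1 : ∀ a b, a ≠ b → Disjoint (Function.update S i (insert v (S i)) a)
        (Function.update S i (insert v (S i)) b) := by
      intro a b hab
      have := hd a b hab
      by_cases ha : a = i
      · subst ha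
        simp [hab.symm, hv, this]
      · by_cases hb : b = i
        · subst hb
          simp [ha, hv, this]
        · simp [ha, hb, this]
    have g0 : ∀ j, (Function.update S i (insert v (S i)) j).card
        = (S j).card + if j = i then 1 else 0 := by
      intro j
      by_cases hji : j = i
      · subst hji
        simp [hv]
      · simp [hji]
    have g2 : ∀ j, (Function.update S i (insert v (S i)) j).card ≤ s j := by
      intro j
      rw [g0]
      have := hc j
      by_cases hji : j = i
      · subst hji
        simp
        omega
      · simpa [hji] using this
    have g3 : ∑ j, (Function.update S i (insert v (S i)) j).card + m = Fintype.card V := by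
      simp only [g0, Finset.sum_add_distrib]
      simp
      omega
    obtain ⟨f, hf, hcard⟩ := ih _ g1 g2 g3
    refine ⟨f, fun j w hw => hf j w ?_, hcard⟩
    by_cases hji : j = i
    · subst hji; simp [hw]
    · simpa [hji] using hw

lemma elf_longest {V : Type*} [Fintype V] (H : SimpleGraph V) (W : Set V)
    (hW : W.Nonempty) :
    ∃ L : List V, L ≠ [] ∧ L.IsChain H.Adj ∧ L.Nodup ∧ (∀ v ∈ L, v ∈ W) ∧
      ∀ L' : List V, L'.IsChain H.Adj → L'.Nodup → (∀ v ∈ L', v ∈ W) → L'.length ≤ L.length := by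
  classical
  obtain ⟨w, hw⟩ := hW
  let P : ℕ → Prop := fun m => ∃ L : List V, L.length = m ∧ L.IsChain H.Adj ∧ L.Nodup ∧
    (∀ v ∈ L, v ∈ W)
  have hb : ∀ m, P m → m ≤ Fintype.card V := by
    rintro m ⟨L, rfl, -, hn, -⟩
    exact hn.length_le_card
  have h1 : P 1 := ⟨[w], by simp, by simp, by simp, by simpa using hw⟩
  obtain ⟨L, hl, hc, hn, hm⟩ := Nat.findGreatest_spec (P := P) (hb 1 h1) h1
  have hmax : ∀ m, P m → m ≤ L.length := by
    intro m hP
    rw [hl]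
    exact Nat.le_findGreatest (hb m hP) hP
  refine ⟨L, ?_, hc, hn, hm, fun L' a b c => hmax _ ⟨L', rfl, a, b, c⟩⟩
  rintro rfl
  have := hmax 1 h1
  simp at this

lemma elf_head_nbr {V : Type*} {H : SimpleGraph V} {W : Set V} {x : V} {t : List V}
    (hW : ∀ v ∈ W, ∀ u, H.Adj v u → u ∈ W)
    (hc : (x :: t).IsChain H.Adj) (hn : (x :: t).Nodup) (hm : ∀ v ∈ x :: t, v ∈ W)
    (hmax : ∀ L' : List V, L'.IsChain H.Adj → L'.Nodup → (∀ v ∈ L', v ∈ W) →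
      L'.length ≤ (x :: t).length) (u : V) (hu : H.Adj x u) : u ∈ t := by
  by_contra hut
  have hxu := hu.ne
  have := hmax (u :: x :: t) (List.isChain_cons_cons.2 ⟨hu.symm, hc⟩)
    (List.nodup_cons.2 ⟨by simp [hut, hxu.symm], hn⟩) (by
      intro v hv
      rcases List.mem_cons.1 hv with rfl | hv
      · exact hW x (hm x (by simp)) _ hu
      · exact hm v hv)
  simp at this

lemma elf_long {V : Type*} [Fintype V] [DecidableEq V] {H : SimpleGraph V} [DecidableRel H.Adj]
    {W : Set V} {L : List V} {d : ℕ} (hd : ∀ v, d ≤ H.degree v)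
    (hW : ∀ v ∈ W, ∀ u, H.Adj v u → u ∈ W) (h0 : L ≠ [])
    (hc : L.IsChain H.Adj) (hn : L.Nodup) (hm : ∀ v ∈ L, v ∈ W)
    (hmax : ∀ L' : List V, L'.IsChain H.Adj → L'.Nodup → (∀ v ∈ L', v ∈ W) →
      L'.length ≤ L.length) : d + 1 ≤ L.length := by
  obtain ⟨x, t, rfl⟩ := List.exists_cons_of_ne_nil h0
  have hsub : H.neighborFinset x ⊆ t.toFinset := by
    intro u hu
    rw [List.mem_toFinset]
    exact elf_head_nbr hW hc hn hm hmax u (by simpa using hu)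
  have h1 := Finset.card_le_card hsub
  have h2 := t.toFinset_card_le
  have h3 := hd x
  rw [SimpleGraph.card_neighborFinset_eq_degree] at h1
  simp
  omega

lemma elf_cycle_closed {V : Type*} {H : SimpleGraph V} {C : List V}
    (hc : C.IsChain H.Adj) (hn : C.Nodup)
    (hcyc : ∀ x ∈ C.getLast?, ∀ y ∈ C.head?, H.Adj x y)
    (hmax : ∀ L' : List V, L'.IsChain H.Adj → L'.Nodup → L'.length ≤ C.length)
    (w z : V) (hw : w ∈ C) (hz : H.Adj w z) : z ∈ C := by
  by_contra hzC
  obtain ⟨s, t, rfl⟩ := List.append_of_mem hw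
  have hc' := List.isChain_append.1 hc
  have hch : ((w :: t) ++ s).IsChain H.Adj := by
    rw [List.isChain_append]
    refine ⟨hc'.2.1, hc'.1, ?_⟩
    intro x hx y hy
    apply hcyc x _ y
    · cases s <;> simp_all
    · simp_all [List.getLast?_append]
  have hp : ((w :: t) ++ s).Perm (s ++ w :: t) := List.perm_append_comm
  have := hmax (z :: ((w :: t) ++ s)) (by
      rw [List.cons_append] at hch ⊢
      exact List.isChain_cons_cons.2 ⟨hz.symm, hch⟩)
    (List.nodup_cons.2 ⟨by rwa [hp.mem_iff], hp.nodup_iff.2 hn⟩)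
  rw [List.length_cons, hp.length_eq] at this
  omega

lemma elf_head_nbr' {V : Type*} {H : SimpleGraph V} {L : List V} (h0 : L ≠ [])
    (hc : L.IsChain H.Adj) (hn : L.Nodup)
    (hmax : ∀ L' : List V, L'.IsChain H.Adj → L'.Nodup → L'.length ≤ L.length)
    (u : V) (hu : H.Adj (L[0]'(List.length_pos_iff.2 h0)) u) : u ∈ L := by
  obtain ⟨x, t, rfl⟩ := List.exists_cons_of_ne_nil h0
  exact List.mem_cons_of_mem _ (elf_head_nbr (W := Set.univ) (by simp) hc hn (by simp)
    (fun L' a b _ => hmax L' a b) u hu)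

lemma elf_last_take {V : Type*} (L : List V) (i : ℕ) (hi : i < L.length) (x : V)
    (hx : x ∈ (L.take (i + 1)).getLast?) : x = L[i] := by
  rw [← List.take_concat_get' L i hi, List.getLast?_concat] at hx
  simpa using hx.symm

lemma elf_last_drop {V : Type*} (L : List V) (i : ℕ) (hi : i + 1 < L.length) (x : V)
    (hx : x ∈ (L.drop (i + 1)).getLast?) : x = L[L.length - 1] := by
  rw [List.getLast?_drop, if_neg (by omega), List.getLast?_eq_getElem?,
    List.getElem?_eq_getElem (by omega)] at hx
  simpa using hx.symm

lemma elf_last_app {V : Type*} (L : List V) (i : ℕ) (hi : i + 1 < L.length) (x : V)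
    (hx : x ∈ (L.take (i + 1) ++ (L.drop (i + 1)).reverse).getLast?) : x = L[i + 1] := by
  rw [List.drop_eq_getElem_cons hi, List.reverse_cons, ← List.append_assoc] at hx
  simpa using hx.symm

lemma elf_head_app {V : Type*} (L : List V) (i : ℕ) (hi : 0 < L.length) (x : V)
    (hx : x ∈ (L.take (i + 1) ++ (L.drop (i + 1)).reverse).head?) : x = L[0] := by
  cases L with
  | nil => simp at hi
  | cons y t => simpa using hx.symm

/-- A longest path with fewer than `2d` vertices spans a set closed under adjacency. -/
lemma elf_closed {V : Type*} [Fintype V] [DecidableEq V] {H : SimpleGraph V} [DecidableRel H.Adj]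
    {L : List V} {d : ℕ} (hd : ∀ v, d ≤ H.degree v) (h0 : L ≠ [])
    (hc : L.IsChain H.Adj) (hn : L.Nodup)
    (hmax : ∀ L' : List V, L'.IsChain H.Adj → L'.Nodup → L'.length ≤ L.length)
    (hlen : L.length < 2 * d) (w z : V) (hw : w ∈ L) (hz : H.Adj w z) : z ∈ L := by
  have hpos : 0 < L.length := List.length_pos_iff.2 h0
  have hfirst : ∀ u, H.Adj L[0] u → u ∈ L := by
    intro u hu
    exact elf_head_nbr' h0 hc hn hmax u hu
  have hlast : ∀ u, H.Adj (L[L.length - 1]) u → u ∈ L := by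
    intro u hu
    have hrc : L.reverse.IsChain H.Adj := by
      rw [List.isChain_reverse]
      exact hc.imp (fun _ _ h => h.symm)
    have hrn : L.reverse.Nodup := List.nodup_reverse.2 hn
    have h0' : L.reverse ≠ [] := by simpa using h0
    have hx : L.reverse[0]'(by simpa using hpos) = L[L.length - 1] := by simp
    rw [← List.mem_reverse]
    exact elf_head_nbr' h0' hrc hrn (by simpa using hmax) u (by rwa [hx])
  let g : ℕ → V := fun i => L.getD i w
  have hg : ∀ i (hi : i < L.length), g i = L[i] := by
    intro i hi
    simp [g, hi]
  let A := (Finset.range (L.length - 1)).filter fun i => H.Adj L[0] (g (i + 1))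
  let B := (Finset.range (L.length - 1)).filter fun i => H.Adj (L[L.length - 1]) (g i)
  have hA : d ≤ A.card := by
    refine (hd L[0]).trans ?_
    rw [← SimpleGraph.card_neighborFinset_eq_degree]
    refine (Finset.card_le_card (t := A.image fun i => g (i + 1)) ?_).trans Finset.card_image_le
    intro u hu
    rw [SimpleGraph.mem_neighborFinset] at hu
    obtain ⟨i, hi, rfl⟩ := List.mem_iff_getElem.1 (hfirst u hu)
    have hi0 : i ≠ 0 := by
      rintro rfl
      exact hu.ne rfl
    obtain ⟨j, rfl⟩ := Nat.exists_eq_succ_of_ne_zero hi0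
    refine Finset.mem_image.2 ⟨j, ?_, hg _ hi⟩
    refine Finset.mem_filter.2 ⟨Finset.mem_range.2 (by omega), ?_⟩
    rw [hg _ hi]
    exact hu
  have hB : d ≤ B.card := by
    refine (hd (L[L.length - 1])).trans ?_
    rw [← SimpleGraph.card_neighborFinset_eq_degree]
    refine (Finset.card_le_card (t := B.image g) ?_).trans Finset.card_image_le
    intro u hu
    rw [SimpleGraph.mem_neighborFinset] at hu
    obtain ⟨i, hi, rfl⟩ := List.mem_iff_getElem.1 (hlast u hu)
    have hi0 : i ≠ L.length - 1 := by
      rintro rfl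
      exact hu.ne rfl
    refine Finset.mem_image.2 ⟨i, ?_, hg _ hi⟩
    refine Finset.mem_filter.2 ⟨Finset.mem_range.2 (by omega), ?_⟩
    rw [hg _ hi]
    exact hu
  have hAB : (A ∩ B).Nonempty := by
    rw [← Finset.card_pos]
    have h1 := Finset.card_union_add_card_inter A B
    have h2 : (A ∪ B).card ≤ L.length - 1 := by
      calc _ ≤ (Finset.range (L.length - 1)).card := Finset.card_le_card
            (Finset.union_subset (Finset.filter_subset _ _) (Finset.filter_subset _ _))
        _ = _ := by simp
    omega
  obtain ⟨i, hi⟩ := hAB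
  obtain ⟨hiA, hiB⟩ := Finset.mem_inter.1 hi
  obtain ⟨hir, hiA⟩ := Finset.mem_filter.1 hiA
  obtain ⟨-, hiB⟩ := Finset.mem_filter.1 hiB
  rw [Finset.mem_range] at hir
  rw [hg _ (by omega)] at hiA hiB
  have hp : (L.take (i + 1) ++ (L.drop (i + 1)).reverse).Perm L := by
    have h1 := List.Perm.append_left (L.take (i + 1)) (List.reverse_perm (L.drop (i + 1)))
    rwa [List.take_append_drop] at h1
  rw [← hp.mem_iff]
  refine elf_cycle_closed (w := w) (H := H) ?_ (hp.nodup_iff.2 hn) ?_ ?_ z (hp.mem_iff.2 hw) hz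
  · rw [List.isChain_append]
    refine ⟨hc.take _, ?_, ?_⟩
    · rw [List.isChain_reverse]
      exact (hc.drop _).imp (fun _ _ h => h.symm)
    · intro x hx y hy
      have hx' : x = L[i] := elf_last_take L i (by omega) x hx
      have hy' : y = L[L.length - 1] := by
        rw [List.head?_reverse] at hy
        exact elf_last_drop L i (by omega) y hy
      rw [hx', hy']
      exact hiB.symm
  · intro x hx y hy
    have hx' : x = L[i+1] := elf_last_app L i (by omega) x hx
    have hy' : y = L[0] := elf_head_app L i hpos y hy
    rw [hx', hy']
    exact hiA.symm
  · rw [hp.length_eq]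
    exact hmax

/-- Cutting a path into `b` quadruples and `a` pairs. -/
lemma elf_cut {V : Type*} {H : SimpleGraph V} (a : ℕ) : ∀ (b : ℕ) (L : List V),
    L.IsChain H.Adj → 4 * b + 2 * a ≤ L.length →
    ∃ L4 L2 : List (List V), L4.length = b ∧ L2.length = a ∧
      (∀ l ∈ L4, l.IsChain H.Adj ∧ l.length = 4) ∧
      (∀ l ∈ L2, l.IsChain H.Adj ∧ l.length = 2) ∧
      (L4 ++ L2).flatten <+: L := by
  intro b
  induction b with
  | zero =>
    induction a with
    | zero =>
      intro L _ _
      exact ⟨[], [], by simp⟩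
    | succ a ih =>
      intro L hc hl
      match L, hc, hl with
      | x :: y :: t, hc, hl =>
        obtain ⟨L4, L2, h4, h2, c4, c2, hp⟩ := ih t (hc.drop 2) (by simp at hl; omega)
        have h4' : L4 = [] := List.length_eq_zero_iff.1 h4
        subst h4'
        refine ⟨[], [x, y] :: L2, rfl, by simp [h2], by simp, ?_, ?_⟩
        · intro l hl
          rcases List.mem_cons.1 hl with rfl | hl
          · exact ⟨hc.take 2, rfl⟩
          · exact c2 l hl
        · simpa using hp
  | succ b ih =>
    intro L hc hl
    match L, hc, hl with
    | x :: y :: z :: w :: t, hc, hl =>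
      obtain ⟨L4, L2, h4, h2, c4, c2, hp⟩ := ih t (hc.drop 4) (by simp at hl; omega)
      refine ⟨[x, y, z, w] :: L4, L2, by simp [h4], h2, ?_, c2, ?_⟩
      · intro l hl
        rcases List.mem_cons.1 hl with rfl | hl
        · exact ⟨hc.take 4, rfl⟩
        · exact c4 l hl
      · simpa using hp
    | [], hc, hl => simp at hl
    | [x], hc, hl => simp at hl; omega
    | [x, y], hc, hl => simp at hl; omega
    | [x, y, z], hc, hl => simp at hl; omega

lemma elf_pack {V : Type*} [Fintype V] [DecidableEq V] (H : SimpleGraph V) [DecidableRel H.Adj]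
    (d a b : ℕ) (hd : ∀ v, d ≤ H.degree v) (hn : 2 * d < Fintype.card V) (ha : 0 < a)
    (hab : a + 2 * b ≤ d) :
    ∃ L4 L2 : List (List V), L4.length = b ∧ L2.length = a ∧
      (∀ l ∈ L4, l.IsChain H.Adj ∧ l.length = 4) ∧
      (∀ l ∈ L2, l.IsChain H.Adj ∧ l.length = 2) ∧
      (L4 ++ L2).flatten.Nodup := by
  have : Nonempty V := Fintype.card_pos_iff.1 (by omega)
  obtain ⟨P, hP0, hPc, hPn, -, hPmax⟩ := elf_longest H Set.univ Set.univ_nonempty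
  have hPmax' : ∀ L' : List V, L'.IsChain H.Adj → L'.Nodup → L'.length ≤ P.length :=
    fun L' a b => hPmax L' a b (by simp)
  by_cases hlen : 2 * d ≤ P.length
  · obtain ⟨L4, L2, h4, h2, c4, c2, hp⟩ := elf_cut (H := H) a b P hPc (by omega)
    exact ⟨L4, L2, h4, h2, c4, c2, hp.sublist.nodup hPn⟩
  push Not at hlen
  have hcl := elf_closed hd hP0 hPc hPn hPmax' hlen
  have hPl := elf_long (W := Set.univ) hd (by simp) hP0 hPc hPn (by simp) hPmax
  have hne : ({v | v ∉ P} : Set V).Nonempty := by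
    by_contra hcon
    rw [Set.not_nonempty_iff_eq_empty, Set.eq_empty_iff_forall_notMem] at hcon
    simp only [Set.mem_ofPred_eq, not_not] at hcon
    have h1 : P.toFinset = Finset.univ := Finset.eq_univ_iff_forall.2 (by simpa using hcon)
    have h2 := P.toFinset_card_le
    rw [h1, Finset.card_univ] at h2
    omega
  obtain ⟨Q, hQ0, hQc, hQn, hQm, hQmax⟩ := elf_longest H _ hne
  have hQl := elf_long (W := {v | v ∉ P}) hd
    (fun v hv u hvu hu => hv (hcl u v hu hvu.symm)) hQ0 hQc hQn hQm hQmax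
  obtain ⟨a1, b1, a2, b2, rfl, rfl, q1, q2⟩ : ∃ a1 b1 a2 b2, a = a1 + a2 ∧ b = b1 + b2 ∧
      4 * b1 + 2 * a1 ≤ P.length ∧ 4 * b2 + 2 * a2 ≤ Q.length := by
    by_cases hb : 4 * b ≤ P.length
    · by_cases ha' : 4 * b + 2 * a ≤ P.length
      · exact ⟨a, b, 0, 0, by omega, by omega, by omega, by omega⟩
      · exact ⟨(P.length - 4 * b) / 2, b, a - (P.length - 4 * b) / 2, 0,
          by omega, by omega, by omega, by omega⟩
    · exact ⟨(P.length % 4) / 2, P.length / 4, a - (P.length % 4) / 2, b - P.length / 4,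
        by omega, by omega, by omega, by omega⟩
  obtain ⟨L4, L2, h4, h2, c4, c2, hp⟩ := elf_cut (H := H) a1 b1 P hPc q1
  obtain ⟨M4, M2, k4, k2, e4, e2, hq⟩ := elf_cut (H := H) a2 b2 Q hQc q2
  refine ⟨L4 ++ M4, L2 ++ M2, by simp [h4, k4], by simp [h2, k2], ?_, ?_, ?_⟩
  · intro l hl
    rcases List.mem_append.1 hl with hl | hl
    · exact c4 l hl
    · exact e4 l hl
  · intro l hl
    rcases List.mem_append.1 hl with hl | hl
    · exact c2 l hl
    · exact e2 l hl
  · have hperm : ((L4 ++ M4) ++ (L2 ++ M2)).Perm ((L4 ++ L2) ++ (M4 ++ M2)) := by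
      rw [← Multiset.coe_eq_coe]
      simp only [← Multiset.coe_add]
      abel
    rw [hperm.flatten.nodup_iff, List.flatten_append, List.nodup_append]
    refine ⟨hp.sublist.nodup hPn, hq.sublist.nodup hQn, ?_⟩
    rintro x hx y hy rfl
    exact hQm x (hq.subset hy) (hp.subset hx)

theorem equitable_linear_forest_partition_of_half_card_le_maxDegree
    {V : Type*} [Fintype V] (G : SimpleGraph V) [DecidableRel G.Adj]
    (h : (G.maxDegree : ℝ) ≥ Fintype.card V / 2) :
    ∃ f : V → Fin ((G.maxDegree + 2) / 2),
      (∀ i,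
        (Finset.univ.filter fun v => f v = i).card
            = Fintype.card V / ((G.maxDegree + 2) / 2) ∨
        (Finset.univ.filter fun v => f v = i).card
            = (Fintype.card V + (G.maxDegree + 2) / 2 - 1) / ((G.maxDegree + 2) / 2)) ∧
      (∀ i, (G.induce (f ⁻¹' {i})).IsAcyclic) ∧
      ∀ i, ∀ v ∈ f ⁻¹' {i}, ({w | w ∈ f ⁻¹' {i} ∧ G.Adj v w}).ncard ≤ 2 := by
  classical
  have hD : Fintype.card V ≤ 2 * G.maxDegree := by
    have : (Fintype.card V : ℝ) ≤ 2 * G.maxDegree := by linarith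
    exact_mod_cast this
  set n := Fintype.card V with hn
  set D := G.maxDegree with hDdef
  have hk : 0 < (D + 2) / 2 := by omega
  have hk4 : n < 4 * ((D + 2) / 2) := by omega
  have hkD : D + 1 ≤ 2 * ((D + 2) / 2) := by omega
  generalize (D + 2) / 2 = k at *
  -- sizes
  set q := n / k with hq
  set m := n % k with hm
  have hqm : k * q + m = n := Nat.div_add_mod n k
  have hmk : m < k := Nat.mod_lt _ hk
  have hq4 : q < 4 := by
    rw [hq, Nat.div_lt_iff_lt_mul hk]; omega
  let s : Fin k → ℕ := fun i => q + if i.1 < m then 1 else 0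
  have hs : ∑ i, s i = n := by
    have h1 : ∑ i : Fin k, (if i.1 < m then 1 else 0) = m := by
      rw [Fin.sum_univ_eq_sum_range (fun i => if i < m then 1 else 0) k, Finset.sum_ite]
      have : (Finset.range k).filter (fun i => i < m) = Finset.range m := by
        ext i; simp; omega
      simp [this]
    simp only [s, Finset.sum_add_distrib, h1]
    simp [hqm]
  -- the packing
  have hpack : ∃ Ls : List (List V), Ls.length ≤ k ∧ Ls.flatten.Nodup ∧
      (∀ i (hi : i < k), (Ls.getD i []).length ≤ s ⟨i, hi⟩) ∧
      (∀ i (hi : i < k), ∀ T : Finset V, T.card = s ⟨i, hi⟩ → (∀ v ∈ Ls.getD i [], v ∈ T) →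
        ElfLin G (T : Set V)) := by
    by_cases hn2 : n ≤ 2 * k
    · refine ⟨[], by simp, by simp, by simp, ?_⟩
      intro i hi T hT _
      apply elfLin_of_card_le_two
      rw [hT]
      simp only [s]
      have : q ≤ 2 := by
        by_contra hcon
        have : k * 3 ≤ k * q := Nat.mul_le_mul_left k (by omega)
        omega
      interval_cases q
      · split_ifs <;> omega
      · split_ifs <;> omega
      · have : m = 0 := by omega
        simp [this]
    push Not at hn2
    have hdeg : ∀ v, n - 1 - D ≤ Gᶜ.degree v := by
      intro v
      have h1 := G.degree_le_maxDegree v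
      rw [SimpleGraph.degree_compl]
      omega
    obtain ⟨a, b, ha, hab, hbk, hsz⟩ : ∃ a b : ℕ, 0 < a ∧ a + 2 * b ≤ n - 1 - D ∧ a + b ≤ k ∧
        ∀ i (hi : i < k), s ⟨i, hi⟩ = if i < b then 4 else if i < b + a then 3 else 2 := by
      have hq2 : 2 ≤ q := by
        rw [hq, Nat.le_div_iff_mul_le hk]; omega
      have : q = 2 ∨ q = 3 := by omega
      rcases this with h2 | h2
      · refine ⟨m, 0, ?_, ?_, ?_, ?_⟩
        · rw [h2] at hqm; omega
        · rw [h2] at hqm; omega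
        · omega
        · intro i hi
          simp only [s, h2]
          split_ifs <;> omega
      · refine ⟨k - m, m, ?_, ?_, ?_, ?_⟩
        · omega
        · rw [h2] at hqm; omega
        · omega
        · intro i hi
          simp only [s, h2]
          split_ifs <;> omega
    obtain ⟨L4, L2, h4, h2, c4, c2, hnd⟩ := elf_pack Gᶜ (n - 1 - D) a b hdeg (by omega) ha hab
    have hget : ∀ i, (i < b → (L4 ++ L2).getD i [] ∈ L4) ∧
        (b ≤ i → i < b + a → (L4 ++ L2).getD i [] ∈ L2) ∧
        (b + a ≤ i → (L4 ++ L2).getD i [] = []) := by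
      intro i
      refine ⟨fun hi => ?_, fun hi hi' => ?_, fun hi => ?_⟩
      · rw [List.getD_append _ _ _ _ (by omega), List.getD_eq_getElem _ _ (by omega)]
        exact List.getElem_mem _
      · rw [List.getD_append_right _ _ _ _ (by omega), List.getD_eq_getElem _ _ (by omega)]
        exact List.getElem_mem _
      · exact List.getD_eq_default _ _ (by simp; omega)
    refine ⟨L4 ++ L2, by simp; omega, hnd, ?_, ?_⟩
    · intro i hi
      rw [hsz i hi]
      obtain ⟨g1, g2, g3⟩ := hget i
      split_ifs with h1 h1'
      · exact (c4 _ (g1 h1)).2.le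
      · rw [(c2 _ (g2 (by omega) h1')).2]; omega
      · rw [g3 (by omega)]; simp
    · intro i hi T hT hsub
      rw [hsz i hi] at hT
      obtain ⟨g1, g2, g3⟩ := hget i
      have hnd' : ∀ l ∈ L4 ++ L2, l.Nodup := (List.nodup_flatten.1 hnd).1
      split_ifs at hT with h1 h1'
      · have e1 := c4 _ (g1 h1)
        have e2 := hnd' _ (List.mem_append_left _ (g1 h1))
        generalize (L4 ++ L2).getD i [] = l at *
        match l, e1 with
        | [x, y, z, w], e1 =>
          have e3 := e1.1
          simp only [List.isChain_cons_cons, SimpleGraph.compl_adj] at e3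
          exact elfLin_of_card_le_four G T hT.le x y z w e2 hsub e3.1.2 e3.2.1.2 e3.2.2.1.2
      · have e1 := c2 _ (g2 (by omega) h1')
        generalize (L4 ++ L2).getD i [] = l at *
        match l, e1 with
        | [x, y], e1 =>
          have e3 := e1.1
          simp only [List.isChain_cons_cons, SimpleGraph.compl_adj] at e3
          exact elfLin_of_card_le_three G T hT.le x y (hsub x (by simp)) (hsub y (by simp))
            e3.1.1 e3.1.2
      · exact elfLin_of_card_le_two G T hT.le
  obtain ⟨Ls, hLk, hLn, hLs, hLT⟩ := hpack
  let S : Fin k → Finset V := fun i => (Ls.getD i.1 []).toFinset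
  have hScard : ∀ i, (S i).card ≤ s i := fun i =>
    (List.toFinset_card_le _).trans (hLs i.1 i.2)
  have hSd : ∀ i j, i ≠ j → Disjoint (S i) (S j) := by
    have hpw := (List.nodup_flatten.1 hLn).2
    have key : ∀ i j : ℕ, i < j → Disjoint (Ls.getD i []).toFinset (Ls.getD j []).toFinset := by
      intro i j hij
      by_cases hj : j < Ls.length
      · rw [List.getD_eq_getElem _ _ hj, List.getD_eq_getElem _ _ (hij.trans hj),
          List.disjoint_toFinset_iff_disjoint]
        exact List.pairwise_iff_getElem.1 hpw i j _ _ hij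
      · rw [List.getD_eq_default _ _ (by omega : Ls.length ≤ j)]
        simp
    intro i j hij
    rcases lt_or_gt_of_ne (fun h => hij (Fin.ext h) : i.1 ≠ j.1) with h | h
    · exact key _ _ h
    · exact (key _ _ h).symm
  have hle : ∑ i, (S i).card ≤ n := hs ▸ Finset.sum_le_sum fun i _ => hScard i
  obtain ⟨f, hf, hfc⟩ := elf_extend s hs (n - ∑ i, (S i).card) S hSd hScard (by omega)
  have hlin : ∀ i, ElfLin G (f ⁻¹' {i}) := by
    intro i
    have h1 := hLT i.1 i.2 (Finset.univ.filter fun v => f v = i) (by rw [← hfc i]) (by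
      intro v hv
      simpa using hf i v (by simpa [S] using hv))
    have h2 : ((Finset.univ.filter fun v => f v = i : Finset V) : Set V) = f ⁻¹' {i} := by
      ext v; simp
    rwa [h2] at h1
  refine ⟨f, fun i => ?_, fun i => (hlin i).acyclic, fun i v hv => (hlin i).deg v hv⟩
  have hfi : (Finset.univ.filter fun v => f v = i).card = q + if i.1 < m then 1 else 0 := hfc i
  by_cases him : i.1 < m
  · right
    rw [if_pos him] at hfi
    rw [hfi]
    symm
    rw [Nat.div_eq_iff hk]
    have : (q + 1) * k = k * q + k := by ring
    constructor <;> omega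
  · left
    rw [if_neg him] at hfi
    exact hfi
end

section
/- For every finite simple graph G, the vertex set of G can be partitioned into at most ⌈(Δ(G)+1)/2⌉ subsets such that each subset induces a forest of G; equivalently, the vertex arboricity satisfies a(G) ≤ ⌈(Δ(G)+1)/2⌉. -/
/-- Greedy step invariant: every finite set of vertices can be coloured without
monochromatic cycles inside it. -/
theorem greedy_forest_colouring
    {V : Type*} [Fintype V] [DecidableEq V] (G : SimpleGraph V) [DecidableRel G.Adj]
    (s : Finset V) :
    ∃ f : V → Fin ((G.maxDegree + 2) / 2),
      ∀ i u (c : G.Walk u u), c.IsCycle → ¬ ∀ x ∈ c.support, x ∈ s ∧ f x = i := by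
  induction s using Finset.induction_on with
  | empty =>
    refine ⟨fun _ => ⟨0, by omega⟩, fun i u c _ h => ?_⟩
    exact absurd (h u c.start_mem_support).1 (Finset.notMem_empty u)
  | insert a s ha ih =>
    obtain ⟨f, hf⟩ := ih
    have hlt : (G.neighborFinset a).card <
        (Finset.univ : Finset (Fin ((G.maxDegree + 2) / 2))).card * 2 := by
      have := G.degree_le_maxDegree a
      rw [← G.card_neighborFinset_eq_degree] at this
      rw [Finset.card_univ, Fintype.card_fin]
      omega
    obtain ⟨j, -, hj⟩ := Finset.exists_card_fiber_lt_of_card_lt_mul (f := f) hlt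
    have hj1 : ∀ x y, G.Adj a x → G.Adj a y → f x = j → f y = j → x = y := by
      intro x y hx hy hfx hfy
      have := Finset.card_le_one.1 (Nat.le_of_lt_succ hj)
      exact this x (by simp [hx, hfx]) y (by simp [hy, hfy])
    refine ⟨Function.update f a j, fun i u c hc h => ?_⟩
    by_cases hac : a ∈ c.support
    · have hij : j = i := by simpa using (h a hac).2
      subst hij
      have hd := hc.rotate hac
      have hs : ∀ x ∈ (c.rotate a hac).support, x ≠ a → f x = j := by
        intro x hx hxa
        have hx' : x ∈ c.support := by
          simpa using hx
        simpa [Function.update_of_ne hxa] using (h x hx').2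
      have h1 := (c.rotate a hac).adj_snd hd.not_nil
      have h2 := (c.rotate a hac).adj_penultimate hd.not_nil
      exact hd.snd_ne_penultimate (hj1 _ _ h1 h2.symm
        (hs _ ((c.rotate a hac).getVert_mem_support _) h1.ne')
        (hs _ ((c.rotate a hac).getVert_mem_support _) h2.ne))
    · refine hf i u c hc fun x hx => ?_
      have hxa : x ≠ a := fun e => hac (e ▸ hx)
      have := h x hx
      rw [Function.update_of_ne hxa, Finset.mem_insert] at this
      exact ⟨this.1.resolve_left hxa, this.2⟩

/-- Chartrand–Kronk–Wall: the vertex set of every graph `G` can be partitioned into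
(at most) `⌈(Δ(G)+1)/2⌉` classes each of which induces a forest of `G`;
i.e. the vertex arboricity satisfies `a(G) ≤ ⌈(Δ(G)+1)/2⌉`. -/
theorem vertexArboricity_le_maxDegree_bound
    {V : Type*} [Fintype V] (G : SimpleGraph V) [DecidableRel G.Adj] :
    ∃ f : V → Fin ((G.maxDegree + 2) / 2),
      ∀ i, (G.induce (f ⁻¹' {i})).IsAcyclic := by
  classical
  obtain ⟨f, hf⟩ := greedy_forest_colouring G Finset.univ
  refine ⟨f, fun i u c hc => ?_⟩
  let e : G.induce (f ⁻¹' {i}) ↪g G := SimpleGraph.Embedding.induce _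
  refine hf i _ (c.map e.toHom) (hc.map e.injective) fun x hx => ⟨Finset.mem_univ x, ?_⟩
  rw [SimpleGraph.Walk.support_map, List.mem_map] at hx
  obtain ⟨y, -, rfl⟩ := hx
  exact y.2
end

section
/- Let G be a finite simple graph on n vertices with (2/3)n − 2 > Δ(G) ≥ n/2, let Γ = ⌈(Δ(G)+1)/2⌉, β = n − 3Γ and μ = 4Γ − n. Suppose the complement graph G^c is disconnected with connected components G_1, …, G_t (t ≥ 2), and let n_1, …, n_t be nonnegative integers with n_1 + ⋯ + n_t = β. Then Σ_{i=1}^t ⌊(δ(G_i) + 1 − 4n_i)/2⌋ ≥ μ, where δ(G_i) is the minimum degree of the component G_i. -/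
/-- Claim 1 of Zhang–Wu: let `G` be an `n`-vertex graph with
`(2/3)n − 2 > Δ(G) ≥ n/2`, set `Γ = ⌈(Δ(G)+1)/2⌉`, `β = n − 3Γ`, `μ = 4Γ − n`.
Suppose the complement `Gᶜ` is disconnected (so it has `t ≥ 2` components), and
assign to each component `C` of `Gᶜ` a natural number `nn C` with `∑ C, nn C = β`.
Then `∑_C ⌊(δ(C) + 1 − 4·nn C)/2⌋ ≥ μ`, where `δ(C)` is the minimum degree of the
component `C` (equivalently, the minimum `Gᶜ`-degree over the vertices of `C`),
and the division on `ℤ` is floor division. -/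
theorem sum_floor_minDegree_components_ge
    {V : Type*} [Fintype V] [DecidableEq V] (G : SimpleGraph V) [DecidableRel G.Adj]
    [Fintype Gᶜ.ConnectedComponent]
    (h1 : (G.maxDegree : ℝ) < 2 / 3 * Fintype.card V - 2)
    (h2 : (G.maxDegree : ℝ) ≥ Fintype.card V / 2)
    (hd : ¬ Gᶜ.Preconnected)
    (nn : Gᶜ.ConnectedComponent → ℕ)
    (hsum : ∑ C : Gᶜ.ConnectedComponent, (nn C : ℤ)
        = Fintype.card V - 3 * ((G.maxDegree + 2) / 2 : ℕ)) :
    ∑ C : Gᶜ.ConnectedComponent,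
        ((sInf ((fun v => Gᶜ.degree v) '' C.supp) : ℤ) + 1 - 4 * nn C) / 2
      ≥ 4 * ((G.maxDegree + 2) / 2 : ℕ) - Fintype.card V := by
  have hdeg : ∀ v, (Fintype.card V : ℤ) - 1 - G.maxDegree ≤ Gᶜ.degree v := by
    intro v
    have a := G.degree_compl v
    have b := G.degree_le_maxDegree v
    omega
  have hlt : G.maxDegree ≤ Fintype.card V := by
    have h : (G.maxDegree : ℝ) ≤ Fintype.card V := by
      have : (0 : ℝ) ≤ Fintype.card V := Nat.cast_nonneg _
      linarith
    exact_mod_cast h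
  have ht : 2 ≤ Fintype.card Gᶜ.ConnectedComponent := by
    by_contra hlt2
    apply hd
    intro u v
    have : Fintype.card Gᶜ.ConnectedComponent ≤ 1 := by omega
    exact SimpleGraph.ConnectedComponent.exact (Fintype.card_le_one_iff.mp this _ _)
  have hterm : ∀ C : Gᶜ.ConnectedComponent,
      ((Fintype.card V : ℤ) - G.maxDegree) / 2 - 2 * nn C ≤
        ((sInf ((fun v => Gᶜ.degree v) '' C.supp) : ℤ) + 1 - 4 * nn C) / 2 := by
    intro C
    have hs : (Fintype.card V : ℤ) - 1 - G.maxDegree ≤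
        (sInf ((fun v => Gᶜ.degree v) '' C.supp) : ℤ) := by
      apply le_csInf
      · exact C.nonempty_supp.image _
      · rintro _ ⟨v, _, rfl⟩
        exact hdeg v
    omega
  have hS := Finset.sum_le_sum (s := Finset.univ) (fun C _ => hterm C)
  rw [Finset.sum_sub_distrib, ← Finset.mul_sum, hsum, Finset.sum_const, Finset.card_univ,
    nsmul_eq_mul] at hS
  have hq : 0 ≤ ((Fintype.card V : ℤ) - G.maxDegree) / 2 := by omega
  have ht' : (2 : ℤ) ≤ (Fintype.card Gᶜ.ConnectedComponent : ℤ) := by exact_mod_cast ht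
  have hm := mul_le_mul_of_nonneg_right ht' hq
  refine ge_iff_le.mpr (le_trans ?_ hS)
  refine le_trans ?_ (sub_le_sub_right hm _)
  omega
end
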